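/- arXiv:1810.05928 — 2 statements merged into one kernel-verified Lean document; each statement's English description precedes it below -/
import Mathlib

section
/- Let ψ be a classical L-periodic solution of the adiabatic Gross–Pitaevskii equation on [0,T), and set Q(t) = ∫₀^L |ψ(t,x)|² dx. Then Q(t) ≤ ( Q(0) − P·L/α )·e^{−αt} + P·L/α for all t ∈ [0,T). -/
section aux17
open MeasureTheory Filter Topology Set


lemma cmono {a b : ℝ} (hab : a ≤ b) {f g : ℝ → ℝ} (hf : Continuous f) (hg : Continuous g)
    (h : ∀ x ∈ Icc a b, f x ≤ g x) : ∫ x in a..b, f x ≤ ∫ x in a..b, g x :=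
  intervalIntegral.integral_mono_on hab (hf.intervalIntegrable a b) (hg.intervalIntegrable a b) h

lemma cadd {a b : ℝ} {f g : ℝ → ℝ} (hf : Continuous f) (hg : Continuous g) :
    ∫ x in a..b, (f x + g x) = (∫ x in a..b, f x) + ∫ x in a..b, g x :=
  intervalIntegral.integral_add (hf.intervalIntegrable a b) (hg.intervalIntegrable a b)

lemma csub {a b : ℝ} {f g : ℝ → ℝ} (hf : Continuous f) (hg : Continuous g) :
    ∫ x in a..b, (f x - g x) = (∫ x in a..b, f x) - ∫ x in a..b, g x :=
  intervalIntegral.integral_sub (hf.intervalIntegrable a b) (hg.intervalIntegrable a b)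

lemma vitali (l : Filter ℝ) [l.IsCountablyGenerated] (a b : ℝ) (hab : a ≤ b) (r : ℝ → ℝ → ℝ)
    (hc : ∀ σ, Continuous (r σ)) (C : ℝ) (hC : ∀ᶠ σ in l, ∫ x in a..b, (r σ x) ^ 2 ≤ C)
    (h0 : ∀ x, Tendsto (fun σ => r σ x) l (𝓝 0)) :
    Tendsto (fun σ => ∫ x in a..b, r σ x) l (𝓝 0) := by
  rw [Metric.tendsto_nhds]
  intro ε hε
  obtain ⟨K, hK, hKC⟩ : ∃ K : ℝ, 0 < K ∧ C / K < ε / 2 := by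
    refine ⟨(|C| + 1) * 2 / ε, by positivity, ?_⟩
    rw [div_lt_iff₀ (by positivity)]
    have : ε / 2 * ((|C| + 1) * 2 / ε) = |C| + 1 := by field_simp
    rw [this]; linarith [le_abs_self C]
  have h1 : Tendsto (fun σ => ∫ x in a..b, min |r σ x| K) l (𝓝 (∫ x in a..b, (0:ℝ))) := by
    apply intervalIntegral.tendsto_integral_filter_of_dominated_convergence (fun _ => K)
    · exact Eventually.of_forall fun σ => 
        (((hc σ).abs.min continuous_const).aestronglyMeasurable)
    · refine Eventually.of_forall fun σ => Eventually.of_forall fun x _ => ?_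
      rw [Real.norm_eq_abs, abs_of_nonneg (le_min (abs_nonneg _) hK.le)]
      exact min_le_right _ _
    · simp
    · refine Eventually.of_forall fun x _ => ?_
      have := (h0 x).abs.min (tendsto_const_nhds (x := K))
      simpa [hK.le] using this
  rw [intervalIntegral.integral_zero] at h1
  filter_upwards [hC, h1.eventually (gt_mem_nhds (half_pos hε))] with σ h2 h3
  rw [dist_zero_right]
  have hi : ∀ f : ℝ → ℝ, Continuous f → IntervalIntegrable f volume a b :=
    fun f hf => hf.intervalIntegrable a b
  have hc1 : Continuous fun x => min |r σ x| K := (hc σ).abs.min continuous_const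
  have hc2 : Continuous fun x => (r σ x) ^ 2 / K := ((hc σ).pow 2).div_const K
  calc ‖∫ x in a..b, r σ x‖ ≤ ∫ x in a..b, ‖r σ x‖ :=
        intervalIntegral.norm_integral_le_integral_norm hab
    _ ≤ ∫ x in a..b, (min |r σ x| K + (r σ x) ^ 2 / K) := by
        refine cmono hab (hc σ).norm (by fun_prop) ?_
        intro x _
        rw [Real.norm_eq_abs]
        rcases le_total |r σ x| K with h | h
        · rw [min_eq_left h]; have : 0 ≤ (r σ x) ^ 2 / K := by positivity
          linarith
        · rw [min_eq_right h]
          have : |r σ x| ≤ (r σ x) ^ 2 / K := by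
            rw [le_div_iff₀ hK, ← sq_abs]; nlinarith [abs_nonneg (r σ x)]
          linarith
    _ = (∫ x in a..b, min |r σ x| K) + (∫ x in a..b, (r σ x) ^ 2) / K := by
        rw [intervalIntegral.integral_add (hi _ hc1) (hi _ hc2), intervalIntegral.integral_div]
    _ < ε := by
        have : (∫ x in a..b, (r σ x) ^ 2) / K ≤ C / K := by gcongr
        linarith

lemma derivL2 (w : ℝ → ℝ → ℂ) (wt : ℝ → ℂ) (s T a b : ℝ) (hs : s < T) (hab : a ≤ b)
    (hw : ∀ σ, Continuous (w σ)) (M : ℝ) (hM : ∀ σ ∈ Icc s T, ∀ x ∈ Icc a b, ‖w σ x‖ ≤ M)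
    (hwt : Continuous wt) (ht : ∀ x, HasDerivWithinAt (fun σ => w σ x) (wt x) (Ici s) s)
    (C : ℝ) (hC : ∀ σ ∈ Icc s T, ∫ x in a..b, ‖w σ x - w s x‖ ^ 2 ≤ C * (σ - s) ^ 2) :
    HasDerivWithinAt (fun σ => ∫ x in a..b, ‖w σ x‖ ^ 2)
      (∫ x in a..b, 2 * inner ℝ (w s x) (wt x)) (Ici s) s := by
  have hi : ∀ f : ℝ → ℝ, Continuous f → IntervalIntegrable f volume a b :=
    fun f hf => hf.intervalIntegrable a b
  set g : ℝ → ℝ := fun x => 2 * inner ℝ (w s x) (wt x) with hg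
  have hgc : Continuous g := continuous_const.mul ((hw s).inner hwt)
  set q : ℝ → ℝ → ℝ := fun σ x => (σ - s)⁻¹ * (‖w σ x‖ ^ 2 - ‖w s x‖ ^ 2) with hq
  have hqc : ∀ σ, Continuous (q σ) := fun σ =>
    continuous_const.mul (((hw σ).norm.pow 2).sub ((hw s).norm.pow 2))
  have key := vitali (𝓝[>] s) a b hab (fun σ x => q σ x - g x) (fun σ => (hqc σ).sub hgc)
    (2 * (4 * M ^ 2 * C) + 2 * ∫ x in a..b, g x ^ 2) ?_ ?_
  · rw [← hasDerivWithinAt_Ioi_iff_Ici, hasDerivWithinAt_iff_tendsto_slope' (by simp)]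
    have h2 := key.add_const (∫ x in a..b, g x)
    rw [zero_add] at h2
    refine h2.congr fun σ => ?_
    rw [csub (hqc σ) hgc, sub_add_cancel, slope_def_module,
      hq, intervalIntegral.integral_const_mul, csub (by fun_prop) (by fun_prop), smul_eq_mul]
  · have hmem : Ioc s T ∈ 𝓝[>] s := Ioc_mem_nhdsGT hs
    filter_upwards [hmem] with σ hσ
    have hσ' : σ ∈ Icc s T := ⟨hσ.1.le, hσ.2⟩
    have hpos : 0 < σ - s := sub_pos.2 hσ.1
    have hdc : Continuous fun x => ‖w σ x - w s x‖ ^ 2 := ((hw σ).sub (hw s)).norm.pow 2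
    have e1 : ∫ x in a..b, q σ x ^ 2 ≤ 4 * M ^ 2 * C := by
      calc ∫ x in a..b, q σ x ^ 2 ≤ ∫ x in a..b, (4 * M ^ 2 * ((σ - s) ^ 2)⁻¹) * ‖w σ x - w s x‖ ^ 2 := by
            refine cmono hab (by fun_prop) (by fun_prop) ?_
            intro x hx
            have m1 := hM σ hσ' x hx
            have m2 := hM s ⟨le_rfl, hs.le⟩ x hx
            have m3 : |‖w σ x‖ - ‖w s x‖| ≤ ‖w σ x - w s x‖ := abs_norm_sub_norm_le _ _
            have n1 := norm_nonneg (w σ x)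
            have n2 := norm_nonneg (w s x)
            have m4 : (‖w σ x‖ - ‖w s x‖) ^ 2 ≤ ‖w σ x - w s x‖ ^ 2 := by
              rw [← sq_abs]; gcongr
            have m5 : (‖w σ x‖ + ‖w s x‖) ^ 2 ≤ 4 * M ^ 2 := by nlinarith
            have : q σ x ^ 2 = ((σ - s) ^ 2)⁻¹ * ((‖w σ x‖ + ‖w s x‖) ^ 2 * (‖w σ x‖ - ‖w s x‖) ^ 2) := by
              simp only [hq]; rw [mul_pow, inv_pow]; ring
            rw [this]
            calc _ ≤ ((σ - s) ^ 2)⁻¹ * ((4 * M ^ 2) * ‖w σ x - w s x‖ ^ 2) := by gcongr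
              _ = _ := by ring
        _ = (4 * M ^ 2 * ((σ - s) ^ 2)⁻¹) * ∫ x in a..b, ‖w σ x - w s x‖ ^ 2 :=
            intervalIntegral.integral_const_mul _ _
        _ ≤ (4 * M ^ 2 * ((σ - s) ^ 2)⁻¹) * (C * (σ - s) ^ 2) := by
            gcongr; exact hC σ hσ'
        _ = _ := by field_simp
    calc ∫ x in a..b, (q σ x - g x) ^ 2 ≤ ∫ x in a..b, (2 * q σ x ^ 2 + 2 * g x ^ 2) := by
          refine cmono hab (by fun_prop) (by fun_prop) ?_
          intro x _
          nlinarith [sq_nonneg (q σ x + g x)]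
      _ = 2 * (∫ x in a..b, q σ x ^ 2) + 2 * ∫ x in a..b, g x ^ 2 := by
          rw [cadd (by fun_prop) (by fun_prop), intervalIntegral.integral_const_mul,
            intervalIntegral.integral_const_mul]
      _ ≤ _ := by linarith
  · intro x
    have h1 := (ht x).norm_sq
    rw [← hasDerivWithinAt_Ioi_iff_Ici, hasDerivWithinAt_iff_tendsto_slope' (by simp)] at h1
    have h2 := h1.sub_const (g x)
    simp only [hg, sub_self] at h2
    refine h2.congr fun σ => ?_
    simp only [slope_def_module, smul_eq_mul, hq, hg]

lemma Zind (F F' : ℝ → ℝ) (hF : Continuous F) (Z : Set ℝ) (hZ : IsClosed Z) (p q : ℝ) (hpq : p ≤ q)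
    (hp : p ∈ Z) (hq : q ∈ Z) (hd : ∀ y ∈ Z, HasDerivAt F (F' y) y) 
    (hd' : ∀ y ∈ Z, y ∈ Icc p q → F' y ≤ 0)
    (hgap : ∀ c ∈ Z, ∀ d ∈ Z, p ≤ c → c < d → d ≤ q → (∀ y ∈ Ioo c d, y ∉ Z) → F d ≤ F c) :
    F q ≤ F p := by
  have main : ∀ ε > 0, F q ≤ F p + ε * (q - p) := by
    intro ε hε
    set S : Set ℝ := {y | y ∈ Z ∧ F y ≤ F p + ε * (y - p)} ∩ Icc p q with hS
    have hSc : IsCompact S := by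
      apply IsCompact.inter_left isCompact_Icc
      exact hZ.inter (isClosed_le hF (by fun_prop))
    have hpS : p ∈ S := ⟨⟨hp, by simp⟩, le_rfl, hpq⟩
    obtain ⟨y, hyS, hymax⟩ := hSc.exists_isGreatest ⟨p, hpS⟩
    obtain ⟨⟨hyZ, hyF⟩, hy1, hy2⟩ := hyS
    rcases hy2.eq_or_lt with h | h
    · rw [← h]; exact hyF
    exfalso
    by_cases hacc : ∃ d ∈ Z, y < d ∧ d ≤ q ∧ ∀ z ∈ Ioo y d, z ∉ Z
    · obtain ⟨d, hdZ, hyd, hdq, hg⟩ := hacc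
      have h1 := hgap y hyZ d hdZ hy1 hyd hdq hg
      have : d ∈ S := ⟨⟨hdZ, by nlinarith⟩, by linarith, hdq⟩
      exact absurd (hymax this) (not_le.2 hyd)
    · push Not at hacc
      have hder := (hd y hyZ)
      have hlt : F' y < ε := lt_of_le_of_lt (hd' y hyZ ⟨hy1, hy2⟩) hε
      have hsl := (hasDerivAt_iff_tendsto_slope.1 hder).eventually (gt_mem_nhds hlt)
      have hsl2 : ∀ᶠ z in 𝓝[>] y, slope F y z < ε :=
        hsl.filter_mono (nhdsWithin_mono _ (fun z hz => (ne_of_gt hz)))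
      obtain ⟨u, hu, hu2⟩ := (mem_nhdsGT_iff_exists_Ioo_subset).1 hsl2
      -- find a point of Z in (y, min u q)
      have : ∃ z ∈ Z, y < z ∧ z < u ∧ z ≤ q := by
        by_contra hno
        push Not at hno
        have hc2 : IsCompact (Z ∩ Icc (min u q) q) := isCompact_Icc.inter_left hZ
        obtain ⟨d, hdm, hdl⟩ := hc2.exists_isLeast ⟨q, hq, min_le_right _ _, le_rfl⟩
        have hyd : y < d := lt_of_lt_of_le (lt_min hu h) hdm.2.1
        obtain ⟨z, hz1, hz2⟩ := hacc d hdm.1 hyd hdm.2.2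
        rcases lt_or_ge z (min u q) with hz | hz
        · have := hno z hz2 hz1.1 (lt_of_lt_of_le hz (min_le_left _ _))
          have := lt_of_lt_of_le hz (min_le_right _ _)
          linarith
        · have := hdl ⟨hz2, hz, by linarith [hz1.2, hdm.2.2]⟩
          linarith [hz1.2]
      obtain ⟨z, hzZ, hyz, hzu, hzq⟩ := this
      have h3 : slope F y z < ε := hu2 ⟨hyz, hzu⟩
      rw [slope_def_field, div_lt_iff₀ (by linarith)] at h3
      have : z ∈ S := ⟨⟨hzZ, by nlinarith⟩, by linarith, hzq⟩
      exact absurd (hymax this) (not_le.2 hyz)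
  refine le_of_forall_pos_le_add fun ε hε => ?_
  have := main (ε / (q - p + 1)) (by have : 0 < q - p + 1 := by linarith
                                     positivity)
  have h2 : ε / (q - p + 1) * (q - p) ≤ ε := by
    rw [div_mul_eq_mul_div, div_le_iff₀ (by linarith)]; nlinarith
  linarith


lemma energyId (w wx wxx f : ℝ → ℂ) (a b : ℝ) (hx : ∀ x, HasDerivAt w (wx x) x)
    (hxx : ∀ x, HasDerivAt wx (wxx x) x) (hc : Continuous wxx) (hf : Continuous f) :
    ∫ x in a..b, 2 * inner ℝ (w x) (Complex.I / 2 * wxx x + f x)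
      = inner ℝ (w b) (Complex.I * wx b) - inner ℝ (w a) (Complex.I * wx a)
        + ∫ x in a..b, 2 * inner ℝ (w x) (f x) := by
  have hw : Continuous w := continuous_iff_continuousAt.2 fun x => (hx x).continuousAt
  have hwx : Continuous wx := continuous_iff_continuousAt.2 fun x => (hxx x).continuousAt
  have h1 : ∀ x, HasDerivAt (fun y => (inner ℝ (w y) (Complex.I * wx y) : ℝ))
      (inner ℝ (w x) (Complex.I * wxx x)) x := by
    intro x
    have := (hx x).inner ℝ ((hxx x).const_mul Complex.I)
    have h00 : (inner ℝ (wx x) (Complex.I * wx x) : ℝ) = 0 := by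
      simp [Complex.inner]; ring
    rw [h00, add_zero] at this
    exact this
  rw [← intervalIntegral.integral_eq_sub_of_hasDerivAt (fun x _ => h1 x)
    (Continuous.intervalIntegrable (by fun_prop) _ _), ← cadd (by fun_prop) (by fun_prop)]
  congr 1
  ext x
  rw [inner_add_right]
  simp [Complex.inner]
  ring

lemma energy (w wx wxx f : ℝ → ℝ → ℂ) (s T c d B : ℝ) (hs : s < T) (hcd : c < d) (hB0 : 0 ≤ B)
    (hw : Continuous (Function.uncurry w)) (hwx : Continuous (Function.uncurry wx))
    (hx : ∀ σ x, HasDerivAt (w σ) (wx σ x) x) (hxx : ∀ σ x, HasDerivAt (wx σ) (wxx σ x) x)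
    (hwxx : ∀ σ, Continuous (wxx σ)) (hf : ∀ σ, Continuous (f σ))
    (hB : ∀ σ ∈ Ico s T, ∀ x ∈ Icc c d, ‖f σ x‖ ≤ B)
    (ht : ∀ σ ∈ Ico s T, ∀ x, HasDerivWithinAt (fun τ => w τ x)
      (Complex.I / 2 * wxx σ x + f σ x) (Ici σ) σ)
    (hc : ∀ σ, w σ c = 0) (hd : ∀ σ, w σ d = 0) (h0 : ∀ x, w s x = 0)
    (hA : ∀ x1 x2, c < x1 → x1 < x2 → x2 < d → ∀ σ ∈ Ico s T, ∃ C, ∀ σ' ∈ Icc σ T,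
      ∫ x in x1..x2, ‖w σ' x - w σ x‖ ^ 2 ≤ C * (σ' - σ) ^ 2) :
    ∫ x in c..d, ‖w T x‖ ^ 2 ≤ 4 * B ^ 2 * (d - c) * (T - s) ^ 2 := by
  have hwσ : ∀ σ, Continuous (w σ) := fun σ => hw.comp (by fun_prop : Continuous fun x : ℝ => (σ, x))
  have hτ : 0 < T - s := sub_pos.2 hs
  set h : ℝ → ℝ → ℝ := fun σ x => inner ℝ (w σ x) (Complex.I * wx σ x) with hh
  have step : ∀ ε ≥ 0, ∀ x1 x2, c < x1 → x1 < x2 → x2 < d → (∀ σ ∈ Icc s T, |h σ x1| ≤ ε) →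
      (∀ σ ∈ Icc s T, |h σ x2| ≤ ε) →
      ∫ x in x1..x2, ‖w T x‖ ^ 2 ≤ 4 * B ^ 2 * (d - c) * (T - s) ^ 2 + 4 * ε * (T - s) := by
    intro ε hε x1 x2 hx1 hx12 hx2 he1 he2
    set y : ℝ → ℝ := fun σ => ∫ x in x1..x2, ‖w σ x‖ ^ 2 with hy
    have hyc : Continuous y :=
      intervalIntegral.continuous_parametric_intervalIntegral_of_continuous' (by
        have : Function.uncurry (fun σ x => ‖w σ x‖ ^ 2) = fun p => ‖Function.uncurry w p‖ ^ 2 := by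
          ext ⟨a, b⟩; rfl
        rw [this]; fun_prop) _ _
    obtain ⟨σm, hσm, hmax⟩ := (isCompact_Icc (a := s) (b := T)).exists_isMaxOn ⟨s, le_rfl, hs.le⟩ hyc.continuousOn
    set Y := y σm with hY
    have hYle : ∀ σ ∈ Icc s T, y σ ≤ Y := fun σ hσ => hmax hσ
    have hy0 : ∀ σ, 0 ≤ y σ := fun σ => intervalIntegral.integral_nonneg hx12.le (fun x _ => by positivity)
    obtain ⟨M, hM⟩ := ((isCompact_Icc (a := s) (b := T)).prod (isCompact_Icc (a := x1) (b := x2))).exists_bound_of_continuousOn hw.continuousOn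
    set K := 2 * ε + Y / (2 * (T - s)) + 2 * (T - s) * B ^ 2 * (d - c) with hK
    have hK0 : 0 ≤ K := by
      have := hy0 σm
      have : 0 ≤ d - c := by linarith
      positivity
    have hder : ∀ σ ∈ Ico s T, HasDerivWithinAt y
        (∫ x in x1..x2, 2 * inner ℝ (w σ x) (Complex.I / 2 * wxx σ x + f σ x)) (Ici σ) σ := by
      intro σ hσ
      obtain ⟨C, hC⟩ := hA x1 x2 hx1 hx12 hx2 σ hσ
      refine derivL2 w (fun x => Complex.I / 2 * wxx σ x + f σ x) σ T x1 x2 hσ.2 hx12.le hwσ M ?_ ?_ (ht σ hσ) C hC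
      · intro σ' hσ' x hx
        exact hM (σ', x) ⟨⟨hσ.1.trans hσ'.1, hσ'.2⟩, hx⟩
      · have := hwxx σ
        have := hf σ
        fun_prop
    have hle : ∀ σ ∈ Ico s T, ∫ x in x1..x2, 2 * inner ℝ (w σ x) (Complex.I / 2 * wxx σ x + f σ x) ≤ K := by
      intro σ hσ
      have hσ' : σ ∈ Icc s T := ⟨hσ.1, hσ.2.le⟩
      have c1 := hwσ σ
      have c2 := hf σ
      rw [energyId _ (wx σ) _ _ _ _ (hx σ) (hxx σ) (hwxx σ) (hf σ)]
      have b1 := (abs_le.1 (he1 σ hσ')).1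
      have b2 := (abs_le.1 (he2 σ hσ')).2
      have b3 : ∫ x in x1..x2, 2 * inner ℝ (w σ x) (f σ x)
          ≤ ∫ x in x1..x2, ((2 * (T - s))⁻¹ * ‖w σ x‖ ^ 2 + 2 * (T - s) * B ^ 2) := by
        refine cmono hx12.le (by fun_prop) (by fun_prop) ?_
        intro x hxm
        have i1 : inner ℝ (w σ x) (f σ x) ≤ ‖w σ x‖ * ‖f σ x‖ := real_inner_le_norm _ _
        have i2 : ‖f σ x‖ ≤ B := hB σ hσ x ⟨by linarith [hxm.1], by linarith [hxm.2]⟩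
        have i3 : ‖w σ x‖ * ‖f σ x‖ ≤ ‖w σ x‖ * B := by gcongr
        have i4 : (2 * (T - s))⁻¹ * ‖w σ x‖ ^ 2 + 2 * (T - s) * B ^ 2 - 2 * (‖w σ x‖ * B)
            = (2 * (T - s))⁻¹ * (‖w σ x‖ - 2 * (T - s) * B) ^ 2 := by
          field_simp; ring
        have i5 : 0 ≤ (2 * (T - s))⁻¹ * (‖w σ x‖ - 2 * (T - s) * B) ^ 2 := by positivity
        linarith
      rw [cadd (by fun_prop) (by fun_prop)] at b3
      simp only [intervalIntegral.integral_const_mul, intervalIntegral.integral_const, smul_eq_mul] at b3 ⊢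
      have b4 : (2 * (T - s))⁻¹ * y σ ≤ Y / (2 * (T - s)) := by
        rw [div_eq_inv_mul]; gcongr; exact hYle σ hσ'
      have b5 : (x2 - x1) * (2 * (T - s) * B ^ 2) ≤ 2 * (T - s) * B ^ 2 * (d - c) := by
        rw [mul_comm]; gcongr
      simp only [hh] at b1 b2
      simp only [hy] at b4
      linarith
    have hfin : y σm ≤ K * (σm - s) := by
      refine image_le_of_deriv_right_le_deriv_boundary (B := fun σ => K * (σ - s)) (B' := fun _ => K)
        hyc.continuousOn hder ?_ (by fun_prop) ?_ hle hσm
      · simp [hy, h0]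
      · intro x _
        simpa using (((hasDerivAt_id x).sub_const s).const_mul K).hasDerivWithinAt
    have hfin2 : Y ≤ K * (T - s) := hfin.trans (by gcongr; exact hσm.2)
    have hKe : K * (T - s) = 2 * ε * (T - s) + Y / 2 + 2 * B ^ 2 * (d - c) * (T - s) ^ 2 := by
      rw [hK]; field_simp
    have := hYle T ⟨hs.le, le_rfl⟩
    simp only [hy] at this
    linarith
  have hhc : Continuous (Function.uncurry h) := by
    have : Function.uncurry h = fun p => inner ℝ (Function.uncurry w p) (Complex.I * Function.uncurry wx p) := by
      ext ⟨a, b⟩; rfl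
    rw [this]; fun_prop
  have near : ∀ z, (∀ σ, w σ z = 0) → ∀ ε > 0, ∀ᶠ x in 𝓝 z, ∀ σ ∈ Icc s T, |h σ x| ≤ ε := by
    intro z hz ε hε
    apply isCompact_Icc.eventually_forall_of_forall_eventually
    intro σ _
    have hcont : Continuous fun p : ℝ × ℝ => |Function.uncurry h (p.2, p.1)| := by fun_prop
    have : (fun p : ℝ × ℝ => |Function.uncurry h (p.2, p.1)|) (z, σ) < ε := by
      simp [hh, hz, hε]
    exact (hcont.continuousAt.eventually (gt_mem_nhds this)).mono fun p hp => le_of_lt hp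
  have lim : ∀ ε > 0, ∫ x in c..d, ‖w T x‖ ^ 2 ≤ 4 * B ^ 2 * (d - c) * (T - s) ^ 2 + 4 * ε * (T - s) := by
    intro ε hε
    have c1 : Tendsto (fun η : ℝ => c + η) (𝓝[>] 0) (𝓝 c) := by
      have : Continuous fun η : ℝ => c + η := by fun_prop
      simpa using (this.tendsto 0).mono_left nhdsWithin_le_nhds
    have c2 : Tendsto (fun η : ℝ => d - η) (𝓝[>] 0) (𝓝 d) := by
      have : Continuous fun η : ℝ => d - η := by fun_prop
      simpa using (this.tendsto 0).mono_left nhdsWithin_le_nhds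
    have hint : ∀ a b : ℝ, IntervalIntegrable (fun x => ‖w T x‖ ^ 2) volume a b := fun a b => by
      have := hwσ T
      exact Continuous.intervalIntegrable (by fun_prop) _ _
    have hG : Continuous fun z => ∫ x in c..z, ‖w T x‖ ^ 2 := intervalIntegral.continuous_primitive hint c
    have c3 : Tendsto (fun η : ℝ => ∫ x in (c + η)..(d - η), ‖w T x‖ ^ 2) (𝓝[>] 0) (𝓝 (∫ x in c..d, ‖w T x‖ ^ 2)) := by
      have := ((hG.tendsto d).comp c2).sub ((hG.tendsto c).comp c1)
      simp only [intervalIntegral.integral_same, sub_zero] at this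
      refine this.congr fun η => ?_
      simp only [Function.comp]
      rw [intervalIntegral.integral_interval_sub_left (hint _ _) (hint _ _)]
    refine le_of_tendsto c3 ?_
    have hmem : Ioo (0:ℝ) ((d - c) / 2) ∈ 𝓝[>] (0:ℝ) := Ioo_mem_nhdsGT (by linarith)
    filter_upwards [hmem, c1.eventually (near c hc ε hε), c2.eventually (near d hd ε hε)] with η h1 h2 h3
    exact step ε hε.le _ _ (by linarith [h1.1]) (by linarith [h1.2]) (by linarith [h1.1]) h2 h3
  refine le_of_forall_pos_le_add fun ε hε => ?_
  have := lim (ε / (4 * (T - s))) (by positivity)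
  have e : 4 * (ε / (4 * (T - s))) * (T - s) = ε := by field_simp
  linarith

def PA (u : ℝ → ℝ → ℂ) (T p q : ℝ) : Prop :=
  ∀ s ∈ Ico 0 T, ∃ C : ℝ, ∀ s' ∈ Icc s T, ∫ x in p..q, ‖u s' x - u s x‖ ^ 2 ≤ C * (s' - s) ^ 2

lemma PA_compact (u : ℝ → ℝ → ℂ) (T x1 x2 : ℝ) (hx : x1 ≤ x2) (hu : ∀ σ, Continuous (u σ))
    (h : ∀ x ∈ Icc x1 x2, ∃ p q, p < x ∧ x < q ∧ PA u T p q) : PA u T x1 x2 := by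
  intro s hs
  have hc : ∀ s', Continuous fun x => ‖u s' x - u s x‖ ^ 2 := fun s' => by
    have := hu s; have := hu s'; fun_prop
  have hio : ∀ s' (S : Set ℝ), IntegrableOn (fun x => ‖u s' x - u s x‖ ^ 2) (Icc x1 x2 ∩ S) :=
    fun s' S => ((hc s').continuousOn.integrableOn_Icc).mono_set inter_subset_left
  have hnn : ∀ s' (μ : Measure ℝ), 0 ≤ᵐ[μ] (fun x => ‖u s' x - u s x‖ ^ 2) :=
    fun s' μ => Eventually.of_forall fun x => by positivity
  have key := (isCompact_Icc (a := x1) (b := x2)).induction_on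
    (p := fun S => ∃ C : ℝ, ∀ s' ∈ Icc s T, ∫ x in Icc x1 x2 ∩ S, ‖u s' x - u s x‖ ^ 2 ≤ C * (s' - s) ^ 2)
    ?_ ?_ ?_ ?_
  · obtain ⟨C, hC⟩ := key
    refine ⟨C, fun s' hs' => ?_⟩
    have := hC s' hs'
    rwa [inter_self, integral_Icc_eq_integral_Ioc, ← intervalIntegral.integral_of_le hx] at this
  · exact ⟨0, by simp⟩
  · rintro S S' hSS ⟨C, hC⟩
    refine ⟨C, fun s' hs' => le_trans ?_ (hC s' hs')⟩
    exact setIntegral_mono_set (hio _ _) (hnn _ _) (LE.le.eventuallyLE (inter_subset_inter_right _ hSS))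
  · rintro S S' ⟨C, hC⟩ ⟨C', hC'⟩
    refine ⟨C + C', fun s' hs' => ?_⟩
    rw [inter_union_distrib_left]
    have h1 := integral_mono_measure (Measure.restrict_union_le (μ := volume) (Icc x1 x2 ∩ S) (Icc x1 x2 ∩ S'))
      (hnn s' _) (Integrable.add_measure (hio s' S) (hio s' S'))
    rw [integral_add_measure (hio s' S) (hio s' S')] at h1
    have := hC s' hs'
    have := hC' s' hs'
    linarith
  · intro x hxm
    obtain ⟨p, q, hp, hq, hA⟩ := h x hxm
    obtain ⟨C, hC⟩ := hA s hs
    refine ⟨Ioc p q, mem_nhdsWithin_of_mem_nhds (Ioc_mem_nhds hp hq), C, fun s' hs' => le_trans ?_ (hC s' hs')⟩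
    rw [intervalIntegral.integral_of_le (by linarith)]
    refine setIntegral_mono_set ?_ (hnn _ _) (LE.le.eventuallyLE inter_subset_right)
    exact ((hc s').continuousOn.integrableOn_Icc).mono_set Ioc_subset_Icc_self


lemma lipT (u ut : ℝ → ℝ → ℂ) (T x n : ℝ) (hu : Continuous (Function.uncurry u))
    (ht : ∀ s ∈ Ico 0 T, HasDerivWithinAt (fun τ => u τ x) (ut s x) (Ici s) s)
    (hn : ∀ s ∈ Ico 0 T, ‖ut s x‖ ≤ n) (σ σ' : ℝ) (h0 : 0 ≤ σ) (h1 : σ ≤ σ') (h2 : σ' ≤ T) :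
    ‖u σ' x - u σ x‖ ≤ n * (σ' - σ) := by
  have hc : Continuous fun τ => u τ x := hu.comp (by fun_prop : Continuous fun τ : ℝ => (τ, x))
  exact norm_image_sub_le_of_norm_deriv_right_le_segment (f := fun τ => u τ x) (f' := fun τ => ut τ x)
    (a := σ) (b := T) hc.continuousOn
    (fun s hs => ht s ⟨h0.trans hs.1, hs.2⟩) (fun s hs => hn s ⟨h0.trans hs.1, hs.2⟩) σ' ⟨h1, h2⟩

lemma gapest (u v a N : ℝ → ℝ → ℂ) (T : ℝ)
    (hu : Continuous (Function.uncurry u)) (hv : Continuous (Function.uncurry v))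
    (hN : Continuous (Function.uncurry N))
    (hux : ∀ σ x, HasDerivAt (u σ) (v σ x) x) (hvx : ∀ σ x, HasDerivAt (v σ) (a σ x) x)
    (ha : ∀ σ, Continuous (a σ))
    (ht : ∀ s ∈ Ico 0 T, ∀ x, HasDerivWithinAt (fun τ => u τ x)
      (Complex.I / 2 * a s x + N s x) (Ici s) s)
    (s s' c d n Ma MN : ℝ) (hs0 : 0 ≤ s) (hss : s < s') (hsT : s' ≤ T) (hcd : c < d)
    (hn0 : 0 ≤ n) (hMa0 : 0 ≤ Ma) (hMN0 : 0 ≤ MN)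
    (hnc : ∀ s ∈ Ico 0 T, ‖Complex.I / 2 * a s c + N s c‖ ≤ n)
    (hnd : ∀ s ∈ Ico 0 T, ‖Complex.I / 2 * a s d + N s d‖ ≤ n)
    (hMa : ∀ x ∈ Icc c d, ‖a s x‖ ≤ Ma) (hMN : ∀ σ ∈ Icc 0 T, ∀ x ∈ Icc c d, ‖N σ x‖ ≤ MN)
    (hA : ∀ x1 x2, c < x1 → x1 < x2 → x2 < d → PA u T x1 x2) :
    ∫ x in c..d, ‖u s' x - u s x‖ ^ 2 ≤ (8 * (Ma + MN + n) ^ 2 + 2 * n ^ 2) * (s' - s) ^ 2 * (d - c) := by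
  have hdc : 0 < d - c := sub_pos.2 hcd
  set ut : ℝ → ℝ → ℂ := fun s x => Complex.I / 2 * a s x + N s x with hut
  set k1 : ℝ → ℝ := fun x => (d - x) / (d - c) with hk1
  set k2 : ℝ → ℝ := fun x => (x - c) / (d - c) with hk2
  have hk1c : Continuous k1 := by simp only [hk1]; fun_prop
  have hk2c : Continuous k2 := by simp only [hk2]; fun_prop
  have hk1n : ∀ x ∈ Icc c d, 0 ≤ k1 x := fun x hx => div_nonneg (by linarith [hx.2]) hdc.le
  have hk2n : ∀ x ∈ Icc c d, 0 ≤ k2 x := fun x hx => div_nonneg (by linarith [hx.1]) hdc.le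
  have hk12 : ∀ x, k1 x + k2 x = 1 := fun x => by simp only [hk1, hk2]; field_simp; ring
  have hcomb : ∀ x ∈ Icc c d, ∀ z1 z2 : ℂ, ∀ K : ℝ, ‖z1‖ ≤ K → ‖z2‖ ≤ K →
      ‖(k1 x : ℂ) * z1 + (k2 x : ℂ) * z2‖ ≤ K := by
    intro x hx z1 z2 K h1 h2
    have e1 := hk1n x hx
    have e2 := hk2n x hx
    calc _ ≤ ‖(k1 x : ℂ) * z1‖ + ‖(k2 x : ℂ) * z2‖ := norm_add_le _ _
      _ = k1 x * ‖z1‖ + k2 x * ‖z2‖ := by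
        rw [norm_mul, norm_mul, Complex.norm_real, Complex.norm_real, Real.norm_of_nonneg e1, Real.norm_of_nonneg e2]
      _ ≤ k1 x * K + k2 x * K := by gcongr
      _ = K := by rw [← add_mul, hk12, one_mul]
  set el : ℝ → ℝ → ℂ := fun σ x => (k1 x : ℂ) * (u σ c - u s c) + (k2 x : ℂ) * (u σ d - u s d) with hel
  set w : ℝ → ℝ → ℂ := fun σ x => u σ x - u s x - el σ x with hw
  set wx : ℝ → ℝ → ℂ := fun σ x => v σ x - v s x - (((-1 / (d - c) : ℝ) : ℂ) * (u σ c - u s c)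
    + ((1 / (d - c) : ℝ) : ℂ) * (u σ d - u s d)) with hwx
  set f : ℝ → ℝ → ℂ := fun σ x => Complex.I / 2 * a s x + N σ x - ((k1 x : ℂ) * ut σ c + (k2 x : ℂ) * ut σ d) with hf
  have hu' : ∀ {g1 g2 : ℝ × ℝ → ℝ}, Continuous g1 → Continuous g2 → Continuous fun p => u (g1 p) (g2 p) :=
    fun h1 h2 => hu.comp (h1.prodMk h2)
  have hv' : ∀ {g1 g2 : ℝ × ℝ → ℝ}, Continuous g1 → Continuous g2 → Continuous fun p => v (g1 p) (g2 p) :=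
    fun h1 h2 => hv.comp (h1.prodMk h2)
  have huσ : ∀ σ, Continuous (u σ) := fun σ => hu.comp (by fun_prop : Continuous fun x : ℝ => (σ, x))
  have hNσ : ∀ σ, Continuous (N σ) := fun σ => hN.comp (by fun_prop : Continuous fun x : ℝ => (σ, x))
  have q1 := hu' continuous_fst continuous_snd
  have q2 := hu' continuous_const continuous_snd (g1 := fun _ => s)
  have q3 := hu' continuous_fst continuous_const (g2 := fun _ => c)
  have q4 := hu' continuous_fst continuous_const (g2 := fun _ => d)
  have hk1' : ∀ x, HasDerivAt (fun x => (k1 x : ℂ)) ((-1 / (d - c) : ℝ) : ℂ) x := fun x => by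
    have : HasDerivAt k1 (-1 / (d - c)) x := ((hasDerivAt_id x).const_sub d).div_const (d - c)
    exact this.ofReal_comp
  have hk2' : ∀ x, HasDerivAt (fun x => (k2 x : ℂ)) ((1 / (d - c) : ℝ) : ℂ) x := fun x => by
    have : HasDerivAt k2 (1 / (d - c)) x := ((hasDerivAt_id x).sub_const c).div_const (d - c)
    exact this.ofReal_comp
  have E := energy w wx (fun σ x => a σ x - a s x) f s s' c d (Ma + MN + n) hss hcd (by positivity)
    ?_ ?_ ?_ ?_ ?_ ?_ ?_ ?_ ?_ ?_ ?_ ?_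
  · -- conclude
    have hel_le : ∀ x ∈ Icc c d, ‖el s' x‖ ≤ n * (s' - s) := fun x hx =>
      hcomb x hx _ _ _ (lipT u ut T c n hu (fun s hs => ht s hs c) hnc s s' hs0 hss.le hsT)
        (lipT u ut T d n hu (fun s hs => ht s hs d) hnd s s' hs0 hss.le hsT)
    have cw : Continuous (w s') := by
      have := huσ s; have := huσ s'
      simp only [hw, hel]; fun_prop
    have g1 := huσ s
    have g2 := huσ s'
    calc ∫ x in c..d, ‖u s' x - u s x‖ ^ 2
        ≤ ∫ x in c..d, (2 * ‖w s' x‖ ^ 2 + 2 * (n * (s' - s)) ^ 2) := by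
          refine cmono hcd.le (by fun_prop) (by fun_prop) fun x hx => ?_
          have e1 := hel_le x hx
          have e2 : ‖u s' x - u s x‖ ≤ ‖w s' x‖ + ‖el s' x‖ := by
            have : u s' x - u s x = w s' x + el s' x := by simp only [hw]; ring
            rw [this]; exact norm_add_le _ _
          have e3 : ‖u s' x - u s x‖ ≤ ‖w s' x‖ + n * (s' - s) := by linarith
          calc ‖u s' x - u s x‖ ^ 2 ≤ (‖w s' x‖ + n * (s' - s)) ^ 2 := by gcongr
            _ ≤ _ := by nlinarith [sq_nonneg (‖w s' x‖ - n * (s' - s))]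
      _ = 2 * (∫ x in c..d, ‖w s' x‖ ^ 2) + (d - c) * (2 * (n * (s' - s)) ^ 2) := by
          rw [cadd (by fun_prop) (by fun_prop), intervalIntegral.integral_const_mul,
            intervalIntegral.integral_const, smul_eq_mul]
      _ ≤ _ := by nlinarith
  · have : Function.uncurry w = fun p => u p.1 p.2 - u s p.2 - ((k1 p.2 : ℂ) * (u p.1 c - u s c) + (k2 p.2 : ℂ) * (u p.1 d - u s d)) := by
      ext ⟨_, _⟩; rfl
    rw [this]; fun_prop
  · have r1 := hv' continuous_fst continuous_snd
    have r2 := hv' continuous_const continuous_snd (g1 := fun _ => s)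
    have : Function.uncurry wx = fun p => v p.1 p.2 - v s p.2 - (((-1 / (d - c) : ℝ) : ℂ) * (u p.1 c - u s c) + ((1 / (d - c) : ℝ) : ℂ) * (u p.1 d - u s d)) := by
      ext ⟨_, _⟩; rfl
    rw [this]; fun_prop
  · intro σ x
    exact ((hux σ x).sub (hux s x)).sub (((hk1' x).mul_const _).add ((hk2' x).mul_const _))
  · intro σ x
    exact ((hvx σ x).sub (hvx s x)).sub_const _
  · intro σ
    exact (ha σ).sub (ha s)
  · intro σ
    have := ha s; have := hNσ σ
    simp only [hf]; fun_prop
  · intro σ hσ x hx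
    have hσ' : σ ∈ Ico 0 T := ⟨hs0.trans hσ.1, lt_of_lt_of_le hσ.2 hsT⟩
    have e1 := hcomb x hx _ _ _ (hnc σ hσ') (hnd σ hσ')
    have e2 : ‖Complex.I / 2 * a s x‖ ≤ Ma := by
      rw [norm_mul]
      have : ‖Complex.I / 2‖ = 1 / 2 := by simp
      rw [this]; have := hMa x hx; linarith [norm_nonneg (a s x)]
    have e3 := hMN σ ⟨hσ'.1, hσ'.2.le⟩ x hx
    exact (norm_sub_le _ _).trans (add_le_add ((norm_add_le _ _).trans (add_le_add e2 e3)) e1)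
  · intro σ hσ x
    have hσ' : σ ∈ Ico 0 T := ⟨hs0.trans hσ.1, lt_of_lt_of_le hσ.2 hsT⟩
    have := ((ht σ hσ' x).sub_const (u s x)).sub
      ((((ht σ hσ' c).sub_const (u s c)).const_mul (k1 x : ℂ)).add
        (((ht σ hσ' d).sub_const (u s d)).const_mul (k2 x : ℂ)))
    refine this.congr_deriv ?_
    simp only [hf, hut]; ring
  · intro σ
    have h1 : k1 c = 1 := by simp only [hk1]; field_simp
    have h2 : k2 c = 0 := by simp only [hk2]; simp
    simp only [hw, hel, h1, h2]; simp
  · intro σ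
    have h1 : k2 d = 1 := by simp only [hk2]; field_simp
    have h2 : k1 d = 0 := by simp only [hk1]; simp
    simp only [hw, hel, h1, h2]; simp
  · intro x
    simp [hw, hel]
  · intro x1 x2 h1 h12 h2 σ hσ
    have hσ' : σ ∈ Ico 0 T := ⟨hs0.trans hσ.1, lt_of_lt_of_le hσ.2 hsT⟩
    obtain ⟨C, hC⟩ := hA x1 x2 h1 h12 h2 σ hσ'
    refine ⟨2 * C + 2 * n ^ 2 * (x2 - x1), fun σ' hσ2 => ?_⟩
    have hT' : σ' ≤ T := hσ2.2.trans hsT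
    have g1 := huσ s
    have g2 := huσ σ'
    have g3 := huσ σ
    have cw : ∀ σ, Continuous (w σ) := fun σ => by
      have := huσ σ
      simp only [hw, hel]; fun_prop
    have cw1 := cw σ
    have cw2 := cw σ'
    have := hC σ' ⟨hσ2.1, hT'⟩
    calc ∫ x in x1..x2, ‖w σ' x - w σ x‖ ^ 2
        ≤ ∫ x in x1..x2, (2 * ‖u σ' x - u σ x‖ ^ 2 + 2 * (n * (σ' - σ)) ^ 2) := by
          refine cmono h12.le (by fun_prop) (by fun_prop) fun x hx => ?_
          have hx' : x ∈ Icc c d := ⟨by linarith [hx.1], by linarith [hx.2]⟩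
          have e1 := hcomb x hx' _ _ _ 
            (lipT u ut T c n hu (fun s hs => ht s hs c) hnc σ σ' hσ'.1 hσ2.1 hT')
            (lipT u ut T d n hu (fun s hs => ht s hs d) hnd σ σ' hσ'.1 hσ2.1 hT')
          have e2 : w σ' x - w σ x = (u σ' x - u σ x) - ((k1 x : ℂ) * (u σ' c - u σ c) + (k2 x : ℂ) * (u σ' d - u σ d)) := by
            simp only [hw, hel]; ring
          have e3 : ‖w σ' x - w σ x‖ ≤ ‖u σ' x - u σ x‖ + n * (σ' - σ) := by
            rw [e2]; exact (norm_sub_le _ _).trans (by linarith)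
          calc ‖w σ' x - w σ x‖ ^ 2 ≤ (‖u σ' x - u σ x‖ + n * (σ' - σ)) ^ 2 := by gcongr
            _ ≤ _ := by nlinarith [sq_nonneg (‖u σ' x - u σ x‖ - n * (σ' - σ))]
      _ = 2 * (∫ x in x1..x2, ‖u σ' x - u σ x‖ ^ 2) + (x2 - x1) * (2 * (n * (σ' - σ)) ^ 2) := by
          rw [cadd (by fun_prop) (by fun_prop), intervalIntegral.integral_const_mul,
            intervalIntegral.integral_const, smul_eq_mul]
      _ ≤ _ := by nlinarith

lemma allPA (u v a N : ℝ → ℝ → ℂ) (T : ℝ)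
    (hu : Continuous (Function.uncurry u)) (hv : Continuous (Function.uncurry v))
    (hN : Continuous (Function.uncurry N))
    (hux : ∀ σ x, HasDerivAt (u σ) (v σ x) x) (hvx : ∀ σ x, HasDerivAt (v σ) (a σ x) x)
    (ha : ∀ σ, Continuous (a σ))
    (ht : ∀ s ∈ Ico 0 T, ∀ x, HasDerivWithinAt (fun τ => u τ x)
      (Complex.I / 2 * a s x + N s x) (Ici s) s)
    (hb : ∀ x, ∃ n : ℝ, ∀ s ∈ Ico 0 T, ‖Complex.I / 2 * a s x + N s x‖ ≤ n)
    (p q : ℝ) (hpq : p ≤ q) : PA u T p q := by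
  have huσ : ∀ σ, Continuous (u σ) := fun σ => hu.comp (by fun_prop : Continuous fun x : ℝ => (σ, x))
  have hNσ : ∀ σ, Continuous (N σ) := fun σ => hN.comp (by fun_prop : Continuous fun x : ℝ => (σ, x))
  set ut : ℝ → ℝ → ℂ := fun s x => Complex.I / 2 * a s x + N s x with hut
  set U : Set ℝ := {x | ∃ p q, p < x ∧ x < q ∧ PA u T p q} with hU
  have hUo : IsOpen U := by
    rw [isOpen_iff_mem_nhds]
    rintro x ⟨p, q, h1, h2, h3⟩
    filter_upwards [Ioo_mem_nhds h1 h2] with y hy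
    exact ⟨p, q, hy.1, hy.2, h3⟩
  suffices hall : ∀ x, x ∈ U from PA_compact u T p q hpq huσ fun x _ => hall x
  by_contra hne
  push Not at hne
  obtain ⟨x0, hx0⟩ := hne
  have hZc : IsClosed Uᶜ := hUo.isClosed_compl
  set En : ℕ → Set ℝ := fun n => {x | ∀ s ∈ Ico 0 T, ‖ut s x‖ ≤ n} with hEn
  have hEc : ∀ n, IsClosed (En n) := by
    intro n
    simp only [hEn, ofPred_forall]
    refine isClosed_iInter fun s => isClosed_iInter fun hs => isClosed_le ?_ continuous_const
    have := ha s; have := hNσ s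
    simp only [hut]; fun_prop
  have hEm : ∀ m n : ℕ, m ≤ n → En m ⊆ En n := fun m n h x hx s hs =>
    (hx s hs).trans (by exact_mod_cast h)
  have hEx : ∀ x, ∃ n, x ∈ En n := by
    intro x
    obtain ⟨n, hn⟩ := hb x
    obtain ⟨k, hk⟩ := exists_nat_ge n
    exact ⟨k, fun s hs => (hn s hs).trans hk⟩
  have : CompleteSpace (Uᶜ : Set ℝ) := hZc.completeSpace_coe
  have : Nonempty (Uᶜ : Set ℝ) := ⟨⟨x0, hx0⟩⟩
  obtain ⟨n0, ⟨z, hzU⟩, hzint⟩ := nonempty_interior_of_iUnion_of_closed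
    (f := fun n => ((↑) : (Uᶜ : Set ℝ) → ℝ) ⁻¹' (En n))
    (fun n => (hEc n).preimage continuous_subtype_val)
    (by
      ext x
      simp only [mem_iUnion, mem_univ, iff_true]
      exact hEx x)
  rw [mem_interior_iff_mem_nhds, nhds_subtype, mem_comap] at hzint
  obtain ⟨O, hO, hOE⟩ := hzint
  obtain ⟨r, hr, hrO⟩ := Metric.nhds_basis_closedBall.mem_iff.1 hO
  rw [Real.closedBall_eq_Icc] at hrO
  simp only at hrO
  set P := z - r with hP
  set Q := z + r with hQ
  have hPQ : P < Q := by linarith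
  obtain ⟨n1, hn1⟩ := hEx P
  obtain ⟨n2, hn2⟩ := hEx Q
  set n := max n0 (max n1 n2) with hn
  set Z : Set ℝ := (Uᶜ ∩ Icc P Q) ∪ {P, Q} with hZ
  have hZcl : IsClosed Z := (hZc.inter isClosed_Icc).union (Set.toFinite _).isClosed
  have hZE : Z ⊆ En n := by
    rintro x (⟨h1, h2⟩ | h | h)
    · have hx : (⟨x, h1⟩ : (Uᶜ : Set ℝ)) ∈ ((↑) : (Uᶜ : Set ℝ) → ℝ) ⁻¹' (En n0) := hOE (hrO h2)
      exact hEm _ _ (le_max_left _ _) hx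
    · rw [h]; exact hEm _ _ ((le_max_left _ _).trans (le_max_right _ _)) hn1
    · rw [h]; exact hEm _ _ ((le_max_right _ _).trans (le_max_right _ _)) hn2
  have hn0 : (0:ℝ) ≤ n := Nat.cast_nonneg _
  refine hzU ⟨P, Q, by linarith, by linarith, ?_⟩
  intro s hs
  obtain ⟨Ma, hMa⟩ := (isCompact_Icc (a := P) (b := Q)).exists_bound_of_continuousOn (ha s).continuousOn
  obtain ⟨MN, hMN⟩ := ((isCompact_Icc (a := 0) (b := T)).prod (isCompact_Icc (a := P) (b := Q))).exists_bound_of_continuousOn hN.continuousOn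
  have hMa0 : 0 ≤ Ma := (norm_nonneg _).trans (hMa P ⟨le_rfl, hPQ.le⟩)
  have hMN0 : 0 ≤ MN := (norm_nonneg _).trans (hMN (s, P) ⟨⟨hs.1, hs.2.le⟩, le_rfl, hPQ.le⟩)
  set K : ℝ := 8 * (Ma + MN + n) ^ 2 + 2 * n ^ 2 with hK
  refine ⟨K * (Q - P), fun s' hs' => ?_⟩
  rcases hs'.1.eq_or_lt with heq | hlt
  · simp [← heq]
  have hDc : Continuous fun x => ‖u s' x - u s x‖ ^ 2 := by
    have := huσ s; have := huσ s'; fun_prop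
  have hint : ∀ a b : ℝ, IntervalIntegrable (fun x => ‖u s' x - u s x‖ ^ 2) volume a b :=
    fun a b => hDc.intervalIntegrable a b
  have main := Zind (fun y => (∫ x in P..y, ‖u s' x - u s x‖ ^ 2) - K * (s' - s) ^ 2 * y)
    (fun y => ‖u s' y - u s y‖ ^ 2 - K * (s' - s) ^ 2)
    ((intervalIntegral.continuous_primitive hint P).sub (by fun_prop)) Z hZcl P Q hPQ.le
    (Or.inr (Or.inl rfl)) (Or.inr (Or.inr rfl)) ?_ ?_ ?_
  · simp only [intervalIntegral.integral_same] at main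
    linarith
  · intro y _
    have h1 := intervalIntegral.integral_hasDerivAt_right (hint P y)
      (hDc.stronglyMeasurableAtFilter _ _) hDc.continuousAt
    have h2 := (hasDerivAt_id y).const_mul (K * (s' - s) ^ 2)
    rw [mul_one] at h2
    exact h1.sub h2
  · intro y hyZ _
    have h1 := lipT u ut T y n hu (fun s hs => ht s hs y) (hZE hyZ) s s' hs.1 hlt.le hs'.2
    have h2 : ‖u s' y - u s y‖ ^ 2 ≤ (n * (s' - s)) ^ 2 := by gcongr
    have h3 : 0 ≤ (8 * (Ma + MN + n) ^ 2 + n ^ 2) * (s' - s) ^ 2 := by positivity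
    rw [hK]; nlinarith
  · intro c hc d hd hPc hcd hdQ hgap
    have hsub : ∀ x ∈ Icc c d, x ∈ Icc P Q := fun x hx => ⟨hPc.trans hx.1, hx.2.trans hdQ⟩
    have g := gapest u v a N T hu hv hN hux hvx ha ht s s' c d n Ma MN hs.1 hlt hs'.2 hcd hn0 hMa0 hMN0
      (hZE hc) (hZE hd) (fun x hx => hMa x (hsub x hx)) (fun σ hσ x hx => hMN (σ, x) ⟨hσ, hsub x hx⟩)
      (fun x1 x2 h1 h12 h2 => PA_compact u T x1 x2 h12.le huσ fun x hx => by
        have hx' : x ∈ Ioo c d := ⟨by linarith [hx.1], by linarith [hx.2]⟩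
        by_contra hxU
        exact hgap x hx' (Or.inl ⟨hxU, hsub x ⟨hx'.1.le, hx'.2.le⟩⟩))
    have e := intervalIntegral.integral_add_adjacent_intervals (hint P c) (hint c d)
    rw [← e]
    nlinarith


noncomputable def GG (g lam α β R P : ℝ) (z : ℂ) : ℂ :=
  ((g * ‖z‖ ^ 2 : ℝ) : ℂ) * z
        + ((lam * P : ℝ) : ℂ) * z / ((β + R * ‖z‖ ^ 2 : ℝ) : ℂ)
        + (Complex.I / 2)
          * (((P * R : ℝ) : ℂ) / ((β + R * ‖z‖ ^ 2 : ℝ) : ℂ) - (α : ℂ)) * z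

lemma GG_cont (g lam α β R P : ℝ) (hβ : 0 < β) (hR : 0 < R) : Continuous (GG g lam α β R P) := by
  have h : ∀ z : ℂ, ((β + R * ‖z‖ ^ 2 : ℝ) : ℂ) ≠ 0 := fun z => by
    have : 0 < β + R * ‖z‖ ^ 2 := by positivity
    exact_mod_cast this.ne'
  unfold GG
  fun_prop (disch := exact h _)

lemma inner_aux (z : ℂ) (A B C : ℝ) :
    2 * inner ℝ z (-Complex.I * ((A : ℂ) * z + (B : ℂ) * z + Complex.I / 2 * (C : ℂ) * z)) = C * ‖z‖ ^ 2 := by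
  rw [← Complex.normSq_eq_norm_sq, Complex.normSq_apply]
  simp [Complex.inner]
  ring

lemma GG_inner (g lam α β R P : ℝ) (hβ : 0 < β) (hR : 0 < R) (hP : 0 < P) (z : ℂ) :
    2 * inner ℝ z (-Complex.I * GG g lam α β R P z) ≤ P - α * ‖z‖ ^ 2 := by
  have h : 0 < β + R * ‖z‖ ^ 2 := by positivity
  have e := inner_aux z (g * ‖z‖ ^ 2) (lam * P / (β + R * ‖z‖ ^ 2)) (P * R / (β + R * ‖z‖ ^ 2) - α)
  have : GG g lam α β R P z = ((g * ‖z‖ ^ 2 : ℝ) : ℂ) * z + ((lam * P / (β + R * ‖z‖ ^ 2) : ℝ) : ℂ) * z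
      + Complex.I / 2 * ((P * R / (β + R * ‖z‖ ^ 2) - α : ℝ) : ℂ) * z := by
    unfold GG; push_cast; ring
  rw [this, e, sub_mul]
  have : P * R / (β + R * ‖z‖ ^ 2) * ‖z‖ ^ 2 ≤ P := by
    rw [div_mul_eq_mul_div, div_le_iff₀ h]; nlinarith
  linarith

lemma absMass (g lam α β R P L t : ℝ) (hα : 0 < α) (hβ : 0 < β) (hR : 0 < R) (hP : 0 < P)
    (hL : 0 < L) (htpos : 0 < t) (u v a N : ℝ → ℝ → ℂ)
    (hNe : ∀ σ x, N σ x = -Complex.I * GG g lam α β R P (u σ x))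
    (cu : Continuous (Function.uncurry u)) (cv : Continuous (Function.uncurry v))
    (cN : Continuous (Function.uncurry N))
    (hux : ∀ σ x, HasDerivAt (u σ) (v σ x) x) (hvx : ∀ σ x, HasDerivAt (v σ) (a σ x) x)
    (ca : ∀ σ, Continuous (a σ))
    (hut : ∀ s ∈ Set.Ico 0 t, ∀ x, HasDerivWithinAt (fun τ => u τ x)
      (Complex.I / 2 * a s x + N s x) (Set.Ici s) s)
    (hb : ∀ x, ∃ n : ℝ, ∀ s ∈ Set.Ico 0 t, ‖Complex.I / 2 * a s x + N s x‖ ≤ n)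
    (hper : ∀ σ x, u σ (x + L) = u σ x) :
    (∫ x in (0:ℝ)..L, ‖u t x‖ ^ 2)
        ≤ ((∫ x in (0:ℝ)..L, ‖u 0 x‖ ^ 2) - P * L / α) * Real.exp (-α * t)
          + P * L / α := by
  have cuσ : ∀ σ, Continuous (u σ) := fun σ =>
    cu.comp (by fun_prop : Continuous fun x : ℝ => (σ, x))
  have hPA := allPA u v a N t cu cv cN hux hvx ca hut hb 0 L hL.le
  set Q : ℝ → ℝ := fun σ => ∫ x in (0:ℝ)..L, ‖u σ x‖ ^ 2 with hQ
  have hQc : Continuous Q :=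
    intervalIntegral.continuous_parametric_intervalIntegral_of_continuous' (by
      have : Function.uncurry (fun σ x => ‖u σ x‖ ^ 2) = fun p => ‖Function.uncurry u p‖ ^ 2 := by
        ext ⟨_, _⟩; rfl
      rw [this]; fun_prop) _ _
  set Q' : ℝ → ℝ := fun s =>
    ∫ x in (0:ℝ)..L, 2 * inner ℝ (u s x) (Complex.I / 2 * a s x + N s x) with hQ'
  obtain ⟨M, hM⟩ := ((isCompact_Icc (a := 0) (b := t)).prod
    (isCompact_Icc (a := 0) (b := L))).exists_bound_of_continuousOn cu.continuousOn
  have cNσ : ∀ σ, Continuous (N σ) := fun σ =>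
    cN.comp (by fun_prop : Continuous fun x : ℝ => (σ, x))
  have hQd : ∀ s ∈ Set.Ico 0 t, HasDerivWithinAt Q (Q' s) (Set.Ici s) s := by
    intro s hs
    obtain ⟨C, hC⟩ := hPA s hs
    refine derivL2 u (fun x => Complex.I / 2 * a s x + N s x) s t 0 L hs.2 hL.le cuσ M ?_ ?_
      (hut s hs) C hC
    · intro σ hσ x hx
      exact hM (σ, x) ⟨⟨hs.1.trans hσ.1, hσ.2⟩, hx⟩
    · have := ca s
      have := cNσ s
      fun_prop
  have hQle : ∀ s, Q' s ≤ P * L - α * Q s := by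
    intro s
    have c1 := cuσ s
    have c2 := cNσ s
    have hvper : v s L = v s 0 := by
      have h1 : HasDerivAt (fun y => u s (y + L)) (v s (0 + L)) 0 := (hux s (0 + L)).comp_add_const 0 L
      have h2 : (fun y => u s (y + L)) = u s := by
        ext y; exact hper s y
      rw [h2, zero_add] at h1
      exact h1.unique (hux s 0)
    have huper : u s L = u s 0 := by
      have := hper s 0
      rwa [zero_add] at this
    simp only [hQ']
    rw [energyId (u s) (v s) (a s) (N s) 0 L (hux s) (hvx s) (ca s) (cNσ s), hvper, huper, sub_self,
      zero_add]
    calc ∫ x in (0:ℝ)..L, 2 * inner ℝ (u s x) (N s x)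
        ≤ ∫ x in (0:ℝ)..L, (P - α * ‖u s x‖ ^ 2) := by
          refine cmono hL.le (by fun_prop) (by fun_prop) fun x _ => ?_
          rw [hNe]
          exact GG_inner g lam α β R P hβ hR hP (u s x)
      _ = P * L - α * Q s := by
          rw [csub (by fun_prop) (by fun_prop), intervalIntegral.integral_const_mul,
            intervalIntegral.integral_const, smul_eq_mul]
          ring
  have hexp : ∀ s, HasDerivAt (fun σ => Real.exp (α * σ)) (Real.exp (α * s) * α) s := fun s => by
    simpa using ((hasDerivAt_id s).const_mul α).exp
  have fin : Real.exp (α * t) * (Q t - P * L / α) ≤ Real.exp (α * 0) * (Q 0 - P * L / α) := by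
    refine image_le_of_deriv_right_le_deriv_boundary
      (f := fun σ => Real.exp (α * σ) * (Q σ - P * L / α))
      (f' := fun s => Real.exp (α * s) * α * (Q s - P * L / α) + Real.exp (α * s) * Q' s)
      (B := fun _ => Real.exp (α * 0) * (Q 0 - P * L / α)) (B' := fun _ => 0) (a := 0) (b := t)
      ?_ ?_ le_rfl continuousOn_const (fun x _ => hasDerivWithinAt_const _ _ _) ?_ ⟨htpos.le, le_rfl⟩
    · exact Continuous.continuousOn (by fun_prop)
    · intro s hs
      exact ((hexp s).hasDerivWithinAt).mul ((hQd s hs).sub_const _)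
    · intro s _
      have e : Real.exp (α * s) * α * (Q s - P * L / α) + Real.exp (α * s) * Q' s
          = Real.exp (α * s) * (α * Q s - P * L + Q' s) := by
        field_simp
      rw [e]
      exact mul_nonpos_of_nonneg_of_nonpos (Real.exp_pos _).le (by linarith [hQle s])
  change Q t ≤ (Q 0 - P * L / α) * Real.exp (-α * t) + P * L / α
  rw [mul_zero, Real.exp_zero, one_mul] at fin
  have h3 : Q t - P * L / α ≤ (Q 0 - P * L / α) * Real.exp (-α * t) := by
    rw [neg_mul, Real.exp_neg, ← div_eq_mul_inv, le_div_iff₀ (Real.exp_pos _)]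
    linarith
  linarith

end aux17

/-- The mass estimate for the adiabatic Gross–Pitaevskii equation (end of Section 5):
`Q(t) ≤ (Q(0) - P L / α) e^{-α t} + P L / α` for `Q(t) = ∫₀^L |ψ(t,x)|² dx`. -/
theorem stmt_17 (g lam α β R P L T : ℝ)
    (hg : 0 < g) (hlam : 0 < lam) (hα : 0 < α) (hβ : 0 < β) (hR : 0 < R) (hP : 0 < P)
    (hL : 0 < L) (hT : 0 < T)
    (ψ : ℝ → ℝ → ℂ) (ψt ψx ψxx : ℝ → ℝ → ℂ)
    -- `L`-periodicity in space
    (hper_ψ : ∀ t x, ψ t (x + L) = ψ t x)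
    -- continuity of the solution
    (hψ_cont : ContinuousOn (fun p : ℝ × ℝ => ψ p.1 p.2) (Set.Ico 0 T ×ˢ Set.univ))
    -- `ψ` continuously differentiable in time
    (hψt : ∀ t ∈ Set.Ico (0:ℝ) T, ∀ x, HasDerivWithinAt (fun s => ψ s x) (ψt t x) (Set.Ico 0 T) t)
    (hψt_cont : ∀ x, ContinuousOn (fun t => ψt t x) (Set.Ico 0 T))
    -- `ψ` twice continuously differentiable in space, with `∂ₓψ` continuous in `(t,x)`
    (hψx : ∀ t ∈ Set.Ico (0:ℝ) T, ∀ x, HasDerivAt (fun y => ψ t y) (ψx t x) x)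
    (hψx_cont : ContinuousOn (fun p : ℝ × ℝ => ψx p.1 p.2) (Set.Ico 0 T ×ˢ Set.univ))
    (hψxx : ∀ t ∈ Set.Ico (0:ℝ) T, ∀ x, HasDerivAt (fun y => ψx t y) (ψxx t x) x)
    (hψxx_cont : ∀ t ∈ Set.Ico (0:ℝ) T, Continuous (fun x => ψxx t x))
    -- the adiabatic Gross-Pitaevskii equation (5.2)
    (heq : ∀ t ∈ Set.Ico (0:ℝ) T, ∀ x,
      Complex.I * ψt t x = -(1/2 : ℂ) * ψxx t x
        + ((g * ‖ψ t x‖ ^ 2 : ℝ) : ℂ) * ψ t x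
        + ((lam * P : ℝ) : ℂ) * ψ t x / ((β + R * ‖ψ t x‖ ^ 2 : ℝ) : ℂ)
        + (Complex.I / 2)
          * (((P * R : ℝ) : ℂ) / ((β + R * ‖ψ t x‖ ^ 2 : ℝ) : ℂ) - (α : ℂ))
          * ψ t x) :
    ∀ t ∈ Set.Ico (0:ℝ) T,
      (∫ x in (0:ℝ)..L, ‖ψ t x‖ ^ 2)
        ≤ ((∫ x in (0:ℝ)..L, ‖ψ 0 x‖ ^ 2) - P * L / α) * Real.exp (-α * t)
          + P * L / α := by
  intro t ht
  rcases ht.1.eq_or_lt with h0 | htpos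
  · rw [← h0]; simp
  have hsubT : Set.Icc 0 t ⊆ Set.Ico 0 T := fun s hs => ⟨hs.1, lt_of_le_of_lt hs.2 ht.2⟩
  set κ : ℝ → ℝ := fun σ => max 0 (min σ t) with hκ
  have hκc : Continuous κ := by simp only [hκ]; fun_prop
  have hκm : ∀ σ, κ σ ∈ Set.Icc 0 t := fun σ =>
    ⟨le_max_left _ _, max_le htpos.le (min_le_right _ _)⟩
  have hκT : ∀ σ, κ σ ∈ Set.Ico 0 T := fun σ => hsubT (hκm σ)
  have hκe : ∀ σ ∈ Set.Icc 0 t, κ σ = σ := fun σ hσ => by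
    simp only [hκ]; rw [min_eq_left hσ.2, max_eq_right hσ.1]
  have hcomp : ∀ F : ℝ → ℝ → ℂ,
      ContinuousOn (fun p : ℝ × ℝ => F p.1 p.2) (Set.Ico 0 T ×ˢ Set.univ) →
      Continuous (Function.uncurry fun σ x => F (κ σ) x) := by
    intro F hF
    have h1 : Continuous fun p : ℝ × ℝ => (κ p.1, p.2) := by fun_prop
    exact hF.comp_continuous h1 fun p => ⟨hκT p.1, Set.mem_univ _⟩
  set u : ℝ → ℝ → ℂ := fun σ x => ψ (κ σ) x with hu
  set v : ℝ → ℝ → ℂ := fun σ x => ψx (κ σ) x with hv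
  set a : ℝ → ℝ → ℂ := fun σ x => ψxx (κ σ) x with ha
  set N : ℝ → ℝ → ℂ := fun σ x => -Complex.I * GG g lam α β R P (u σ x) with hN
  have cu : Continuous (Function.uncurry u) := hcomp ψ hψ_cont
  have cv : Continuous (Function.uncurry v) := hcomp ψx hψx_cont
  have cG := GG_cont g lam α β R P hβ hR
  have cN : Continuous (Function.uncurry N) := by
    have : Function.uncurry N
        = fun p => -Complex.I * GG g lam α β R P (Function.uncurry u p) := by
      ext ⟨_, _⟩; rfl
    rw [this]; fun_prop
  have cuσ : ∀ σ, Continuous (u σ) := fun σ =>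
    cu.comp (by fun_prop : Continuous fun x : ℝ => (σ, x))
  have ca : ∀ σ, Continuous (a σ) := fun σ => hψxx_cont _ (hκT σ)
  have hux : ∀ σ x, HasDerivAt (u σ) (v σ x) x := fun σ x => hψx _ (hκT σ) x
  have hvx : ∀ σ x, HasDerivAt (v σ) (a σ x) x := fun σ x => hψxx _ (hκT σ) x
  have eqt : ∀ s ∈ Set.Ico 0 t, ∀ x, Complex.I / 2 * a s x + N s x = ψt s x := by
    intro s hs x
    have hs' : s ∈ Set.Icc 0 t := ⟨hs.1, hs.2.le⟩
    have h1 := heq s (hsubT hs') x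
    have h2 : Complex.I * ψt s x = -(1/2 : ℂ) * ψxx s x + GG g lam α β R P (ψ s x) := by
      rw [h1]; unfold GG; ring
    simp only [ha, hN, hu, hκe s hs']
    have h3 : ψt s x = -Complex.I * (Complex.I * ψt s x) := by
      rw [← mul_assoc, neg_mul, Complex.I_mul_I]; ring
    rw [h3, h2]; ring
  have hut : ∀ s ∈ Set.Ico 0 t, ∀ x, HasDerivWithinAt (fun τ => u τ x)
      (Complex.I / 2 * a s x + N s x) (Set.Ici s) s := by
    intro s hs x
    rw [eqt s hs x]
    have hs' : s ∈ Set.Icc 0 t := ⟨hs.1, hs.2.le⟩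
    have hmem : Set.Ico s t ∈ nhdsWithin s (Set.Ici s) := Ico_mem_nhdsGE hs.2
    have h1 := ((hψt s (hsubT hs') x).mono
      (fun y hy => ⟨hs.1.trans hy.1, hy.2.trans ht.2⟩ : Set.Ico s t ⊆ Set.Ico 0 T)).mono_of_mem_nhdsWithin hmem
    refine h1.congr_of_eventuallyEq ?_ ?_
    · filter_upwards [hmem] with y hy
      simp only [hu, hκe y ⟨hs.1.trans hy.1, hy.2.le⟩]
    · simp only [hu, hκe s hs']
  have hb : ∀ x, ∃ n : ℝ, ∀ s ∈ Set.Ico 0 t, ‖Complex.I / 2 * a s x + N s x‖ ≤ n := by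
    intro x
    obtain ⟨n, hn⟩ := (isCompact_Icc (a := 0) (b := t)).exists_bound_of_continuousOn
      ((hψt_cont x).mono hsubT)
    exact ⟨n, fun s hs => by rw [eqt s hs x]; exact hn s ⟨hs.1, hs.2.le⟩⟩
  have fin := absMass g lam α β R P L t hα hβ hR hP hL htpos u v a N (fun _ _ => rfl) cu cv cN hux hvx
    ca hut hb (fun σ x => hper_ψ (κ σ) x)
  simp only [hu, hκe t ⟨htpos.le, le_rfl⟩, hκe 0 ⟨le_rfl, htpos.le⟩] at fin
  exact fin
end

section
/- Let ψ be a classical L-periodic solution of the adiabatic Gross–Pitaevskii equation on [0,∞), and assume PR − αβ < 0. Then with κ := (αβ − PR)/(2β) > 0, one has ∫₀^L |ψ(t,x)|² dx ≤ e^{−2κt} · ∫₀^L |ψ(0,x)|² dx for all t ≥ 0; equivalently, the L² norm of ψ(t,·) over one period is at most e^{−κt} times that of ψ(0,·). -/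
open MeasureTheory Set Filter Topology

/-- bounded in L², pointwise convergent to zero implies L¹ convergence to zero -/
lemma aux_vitali (G : ℝ → ℝ → ℝ) (l : Filter ℝ) [l.IsCountablyGenerated] (a b C : ℝ) (hab : a ≤ b)
    (hG : ∀ s, Continuous (G s)) (hlim : ∀ x, Tendsto (fun s => G s x) l (𝓝 0))
    (hC : ∀ᶠ s in l, ∫ x in a..b, (G s x)^2 ≤ C) :
    Tendsto (fun s => ∫ x in a..b, G s x) l (𝓝 0) := by
  rw [Metric.tendsto_nhds]
  intro ε hε
  set M : ℝ := 2 * (|C| + 1) / ε with hM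
  have hMpos : 0 < M := by positivity
  have h1 : Tendsto (fun s => ∫ x in a..b, min |G s x| M) l (𝓝 (∫ x in a..b, (0:ℝ))) := by
    apply intervalIntegral.tendsto_integral_filter_of_dominated_convergence (fun _ => M)
    · filter_upwards with s
      exact ((hG s).abs.min continuous_const).aestronglyMeasurable
    · filter_upwards with s
      filter_upwards with x hx
      rw [Real.norm_eq_abs, abs_of_nonneg (le_min (abs_nonneg _) hMpos.le)]
      exact min_le_right _ _
    · exact intervalIntegrable_const
    · filter_upwards with x hx
      have := ((hlim x).abs).min (tendsto_const_nhds (x := M))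
      simpa [hMpos.le] using this
  simp only [intervalIntegral.integral_zero] at h1
  rw [Metric.tendsto_nhds] at h1
  filter_upwards [h1 (ε/2) (by positivity), hC] with s hs hCs
  simp only [Real.dist_eq, sub_zero] at hs ⊢
  have hi1 : IntervalIntegrable (fun x => min |G s x| M) volume a b :=
    ((hG s).abs.min continuous_const).intervalIntegrable _ _
  have hi2 : IntervalIntegrable (fun x => (G s x)^2 / M) volume a b :=
    (((hG s).pow 2).div_const M).intervalIntegrable _ _
  have h2 : |∫ x in a..b, G s x| ≤ ∫ x in a..b, |G s x| :=
    intervalIntegral.abs_integral_le_integral_abs hab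
  have h3 : (∫ x in a..b, |G s x|) ≤ ∫ x in a..b, (min |G s x| M + (G s x)^2 / M) := by
    apply intervalIntegral.integral_mono_on hab ((hG s).abs.intervalIntegrable _ _) (hi1.add hi2)
    intro x _
    rcases le_total (|G s x|) M with h | h
    · rw [min_eq_left h]
      have : 0 ≤ (G s x)^2 / M := by positivity
      linarith
    · rw [min_eq_right h]
      have : |G s x| ≤ (G s x)^2 / M := by
        rw [le_div_iff₀ hMpos, ← sq_abs, sq]
        gcongr
      linarith
  rw [intervalIntegral.integral_add hi1 hi2, intervalIntegral.integral_div] at h3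
  have h4 : (∫ x in a..b, (G s x)^2) / M ≤ |C| / M := by
    gcongr
    exact hCs.trans (le_abs_self _)
  have h5 : |C| / M < ε / 2 := by
    rw [div_lt_iff₀ hMpos, hM]
    have : ε / 2 * (2 * (|C| + 1) / ε) = |C| + 1 := by field_simp
    rw [this]; linarith
  have := le_abs_self (∫ x in a..b, min |G s x| M)
  linarith

lemma aux_deriv (w : ℝ → ℝ → ℂ) (wt : ℝ → ℂ) (T c d C t1 : ℝ) (hcd : c ≤ d)
    (hw : Continuous (Function.uncurry w)) (hwt : Continuous wt) (ht1 : t1 ∈ Icc 0 T)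
    (hd : ∀ x, HasDerivWithinAt (fun s => w s x) (wt x) (Icc 0 T) t1)
    (hC : ∀ s ∈ Icc 0 T, ∫ x in c..d, ‖w s x - w t1 x‖^2 ≤ C * (s - t1)^2) :
    HasDerivWithinAt (fun t => ∫ x in c..d, ‖w t x‖^2)
      (∫ x in c..d, 2 * ((starRingEnd ℂ) (w t1 x) * wt x).re) (Icc 0 T) t1 := by
  have hws : ∀ s, Continuous (w s) := fun s => hw.comp (Continuous.prodMk_right s)
  obtain ⟨B, hB⟩ : ∃ B, ∀ p ∈ Icc 0 T ×ˢ Icc c d, ‖Function.uncurry w p‖ ≤ B :=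
    (isCompact_Icc.prod isCompact_Icc).exists_bound_of_continuousOn hw.continuousOn
  rw [hasDerivWithinAt_iff_tendsto_slope]
  set D : ℝ → ℝ := fun x => 2 * ((starRingEnd ℂ) (w t1 x) * wt x).re with hD
  have hDc : Continuous D := by
    have := hws t1
    have h2 : Continuous fun x => (starRingEnd ℂ) (w t1 x) * wt x :=
      (Complex.continuous_conj.comp this).mul hwt
    exact continuous_const.mul (Complex.continuous_re.comp h2)
  set G : ℝ → ℝ → ℝ := fun s x => (s - t1)⁻¹ * (‖w s x‖^2 - ‖w t1 x‖^2) - D x with hG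
  have hGc : ∀ s, Continuous (G s) := fun s =>
    (continuous_const.mul (((hws s).norm.pow 2).sub ((hws t1).norm.pow 2))).sub hDc
  have hlim : ∀ x, Tendsto (fun s => G s x) (𝓝[Icc 0 T \ {t1}] t1) (𝓝 0) := by
    intro x
    have h1 : HasDerivWithinAt (fun s => ‖w s x‖^2) (2 * inner ℝ (w t1 x) (wt x)) (Icc 0 T) t1 :=
      (hd x).norm_sq
    rw [hasDerivWithinAt_iff_tendsto_slope] at h1
    have h2 : 2 * inner ℝ (w t1 x) (wt x) = D x := by
      simp [hD, Complex.inner, mul_comm]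
    rw [h2] at h1
    have := h1.sub_const (D x)
    simpa [slope_def_field, slope, hG] using this
  have hbd : ∀ᶠ s in 𝓝[Icc 0 T \ {t1}] t1, ∫ x in c..d, (G s x)^2
      ≤ 8 * B^2 * C + 2 * ∫ x in c..d, (D x)^2 := by
    filter_upwards [self_mem_nhdsWithin] with s hs
    have hst : s - t1 ≠ 0 := sub_ne_zero.2 (fun h => hs.2 h)
    have hint : Continuous fun x => ‖w s x - w t1 x‖^2 := ((hws s).sub (hws t1)).norm.pow 2
    have hle : (∫ x in c..d, (G s x)^2) ≤
        ∫ x in c..d, ((8 * B^2 * ((s-t1)^2)⁻¹) * ‖w s x - w t1 x‖^2 + 2 * (D x)^2) := by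
      apply intervalIntegral.integral_mono_on hcd
      · exact ((hGc s).pow 2).intervalIntegrable _ _
      · exact ((continuous_const.mul hint).add
          (continuous_const.mul (hDc.pow 2))).intervalIntegrable _ _
      intro x hx
      have hb1 : ‖w s x‖ ≤ B := hB (s, x) ⟨hs.1, hx⟩
      have hb2 : ‖w t1 x‖ ≤ B := hB (t1, x) ⟨ht1, hx⟩
      have h1 : (‖w s x‖^2 - ‖w t1 x‖^2)^2 ≤ 4 * B^2 * ‖w s x - w t1 x‖^2 := by
        have e1 : (‖w s x‖ - ‖w t1 x‖)^2 ≤ ‖w s x - w t1 x‖^2 := by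
          rw [← sq_abs]; gcongr; exact abs_norm_sub_norm_le _ _
        have e2 : (‖w s x‖ + ‖w t1 x‖)^2 ≤ (2*B)^2 := by
          gcongr; linarith
        calc (‖w s x‖^2 - ‖w t1 x‖^2)^2 = (‖w s x‖ + ‖w t1 x‖)^2 * (‖w s x‖ - ‖w t1 x‖)^2 := by ring
          _ ≤ (2*B)^2 * ‖w s x - w t1 x‖^2 := by gcongr
          _ = _ := by ring
      set Z := (s - t1)⁻¹ * (‖w s x‖^2 - ‖w t1 x‖^2) with hZ
      have h2 : Z^2 ≤ ((s-t1)^2)⁻¹ * (4 * B^2 * ‖w s x - w t1 x‖^2) := by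
        rw [hZ, mul_pow, inv_pow]; gcongr
      have h3 : (G s x)^2 = (Z - D x)^2 := rfl
      rw [h3]
      nlinarith [sq_nonneg (Z + D x)]
    have hia : IntervalIntegrable (fun x => (8 * B^2 * ((s-t1)^2)⁻¹) * ‖w s x - w t1 x‖^2)
      volume c d := (continuous_const.mul hint).intervalIntegrable _ _
    have hib : IntervalIntegrable (fun x => 2 * (D x)^2) volume c d :=
      (continuous_const.mul (hDc.pow 2)).intervalIntegrable _ _
    rw [intervalIntegral.integral_add hia hib,
      intervalIntegral.integral_const_mul, intervalIntegral.integral_const_mul] at hle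
    refine hle.trans ?_
    have := hC s hs.1
    have h4 : 8 * B^2 * ((s-t1)^2)⁻¹ * (∫ x in c..d, ‖w s x - w t1 x‖^2)
        ≤ 8 * B^2 * ((s-t1)^2)⁻¹ * (C * (s-t1)^2) := by gcongr
    have h5 : 8 * B^2 * ((s-t1)^2)⁻¹ * (C * (s-t1)^2) = 8 * B^2 * C := by field_simp
    linarith
  have hv := aux_vitali G _ c d _ hcd hGc hlim hbd
  have hv2 := hv.add_const (∫ x in c..d, D x)
  rw [zero_add] at hv2
  refine hv2.congr fun s => ?_
  have hi : ∀ s, IntervalIntegrable (fun x => ‖w s x‖^2) volume c d := fun s =>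
    ((hws s).norm.pow 2).intervalIntegrable _ _
  rw [hG, intervalIntegral.integral_sub (((hi s).sub (hi t1)).const_mul _)
    (hDc.intervalIntegrable _ _), intervalIntegral.integral_const_mul,
    intervalIntegral.integral_sub (hi s) (hi t1)]
  simp [slope]

lemma aux_components (V : Set ℝ) (hV : IsOpen V) (i0 i1 : ℝ) (hsub : V ⊆ Ioo i0 i1)
    (f : ℝ → ENNReal) (K : ENNReal)
    (h : ∀ a b, a < b → a ∈ Icc i0 i1 → b ∈ Icc i0 i1 → a ∉ V → b ∉ V → Ioo a b ⊆ V →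
      ∫⁻ x in Ioo a b, f x ≤ K * volume (Ioo a b)) :
    ∫⁻ x in V, f x ≤ K * volume V := by
  set S : Set (ℝ × ℝ) := {p | p.1 < p.2 ∧ p.1 ∈ Icc i0 i1 ∧ p.2 ∈ Icc i0 i1 ∧
    p.1 ∉ V ∧ p.2 ∉ V ∧ Ioo p.1 p.2 ⊆ V} with hS
  have hdisj : S.PairwiseDisjoint (fun p => Ioo p.1 p.2) := by
    rintro ⟨a, b⟩ ⟨h1, -, -, h2, h3, h4⟩ ⟨a', b'⟩ ⟨h1', -, -, h2', h3', h4'⟩ hne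
    simp only [Function.onFun] at *
    rw [Set.disjoint_left]
    rintro z ⟨hz1, hz2⟩ ⟨hz1', hz2'⟩
    apply hne
    have ha : a = a' := by
      rcases lt_trichotomy a a' with h | h | h
      · exact absurd (h4 ⟨h, hz1'.trans hz2⟩) h2'
      · exact h
      · exact absurd (h4' ⟨h, hz1.trans hz2'⟩) h2
    have hb : b = b' := by
      rcases lt_trichotomy b b' with h | h | h
      · exact absurd (h4' ⟨hz1'.trans hz2, h⟩) h3
      · exact h
      · exact absurd (h4 ⟨hz1.trans hz2', h⟩) h3'
    rw [ha, hb]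
  have hcount : S.Countable := hdisj.countable_of_isOpen (fun p _ => isOpen_Ioo)
    (fun p hp => nonempty_Ioo.2 hp.1)
  have hun : V = ⋃ p ∈ S, Ioo p.1 p.2 := by
    apply Subset.antisymm
    · intro x hx
      have hx' := hsub hx
      -- left endpoint
      have hcl : IsClosed (Vᶜ) := hV.isClosed_compl
      have h0 : i0 ∉ V := fun h => lt_irrefl _ (hsub h).1
      have h1 : i1 ∉ V := fun h => lt_irrefl _ (hsub h).2
      have hL : IsCompact (Vᶜ ∩ Icc i0 x) := isCompact_Icc.inter_left hcl
      have hR : IsCompact (Vᶜ ∩ Icc x i1) := isCompact_Icc.inter_left hcl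
      obtain ⟨a, ha, ha'⟩ := hL.exists_isGreatest ⟨i0, h0, le_refl _, hx'.1.le⟩
      obtain ⟨b, hb, hb'⟩ := hR.exists_isLeast ⟨i1, h1, hx'.2.le, le_refl _⟩
      have hax : a < x := lt_of_le_of_ne ha.2.2 (fun h => ha.1 (h ▸ hx))
      have hxb : x < b := lt_of_le_of_ne hb.2.1 (fun h => hb.1 (h ▸ hx))
      refine mem_iUnion₂.2 ⟨(a, b), ⟨hax.trans hxb, ⟨ha.2.1, hax.le.trans hx'.2.le⟩,
        ⟨hx'.1.le.trans hxb.le, hb.2.2⟩, ha.1, hb.1, ?_⟩, hax, hxb⟩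
      rintro y ⟨hy1, hy2⟩
      by_contra hy
      rcases le_total y x with hyx | hyx
      · exact absurd (ha' ⟨hy, ha.2.1.trans hy1.le, hyx⟩) (not_le.2 hy1)
      · exact absurd (hb' ⟨hy, hyx, hy2.le.trans hb.2.2⟩) (not_le.2 hy2)
    · exact iUnion₂_subset fun p hp => hp.2.2.2.2.2
  rw [hun, lintegral_biUnion hcount (fun p _ => measurableSet_Ioo) hdisj,
    measure_biUnion hcount hdisj (fun p _ => measurableSet_Ioo), ← ENNReal.tsum_mul_left]
  exact ENNReal.tsum_le_tsum fun p =>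
    h _ _ p.2.1 p.2.2.1 p.2.2.2.1 p.2.2.2.2.1 p.2.2.2.2.2.1 p.2.2.2.2.2.2

lemma aux_parts (w wx wxx : ℝ → ℂ) (c d : ℝ)
    (h1 : ∀ x, HasDerivAt w (wx x) x) (h2 : ∀ x, HasDerivAt wx (wxx x) x)
    (h3 : Continuous wxx) :
    ∫ x in c..d, (Complex.I * ((starRingEnd ℂ) (w x) * wxx x)).re
      = (Complex.I * ((starRingEnd ℂ) (w d) * wx d)).re
        - (Complex.I * ((starRingEnd ℂ) (w c) * wx c)).re := by
  have hw : Continuous w := continuous_iff_continuousAt.2 fun x => (h1 x).continuousAt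
  apply intervalIntegral.integral_eq_sub_of_hasDerivAt
    (f := fun x => (Complex.I * ((starRingEnd ℂ) (w x) * wx x)).re)
  · intro x _
    have e1 : HasDerivAt (fun y => (starRingEnd ℂ) (w y)) ((starRingEnd ℂ) (wx x)) x :=
      (h1 x).star
    have e2 := ((e1.mul (h2 x)).const_mul Complex.I)
    have e3 := (Complex.reCLM.hasFDerivAt.comp_hasDerivAt x e2)
    refine e3.congr_deriv ?_
    simp only [Complex.reCLM_apply, mul_add, Complex.add_re, add_eq_right]
    rw [mul_comm ((starRingEnd ℂ) (wx x)), Complex.mul_conj]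
    simp
  · apply Continuous.intervalIntegrable
    exact Complex.continuous_re.comp (continuous_const.mul ((Complex.continuous_conj.comp hw).mul h3))

set_option maxHeartbeats 2000000 in
lemma aux_energy (T a b K t0 : ℝ) (hab : a < b) (ht0 : t0 ∈ Icc 0 T)
    (w wx wxx wt : ℝ → ℝ → ℂ)
    (hw : Continuous (Function.uncurry w)) (hwx : Continuous (Function.uncurry wx))
    (hwxx : ∀ t, Continuous (wxx t)) (hwt : ∀ t, Continuous (wt t))
    (hd1 : ∀ t x, HasDerivAt (w t) (wx t x) x) (hd2 : ∀ t x, HasDerivAt (wx t) (wxx t x) x)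
    (hdt : ∀ t ∈ Icc 0 T, ∀ x, HasDerivWithinAt (fun s => w s x) (wt t x) (Icc 0 T) t)
    (hs : ∀ t ∈ Icc 0 T, ∀ x ∈ Icc a b, ‖wt t x - Complex.I / 2 * wxx t x‖ ≤ K)
    (ha : ∀ t, w t a = 0) (hb : ∀ t, w t b = 0) (h0 : ∀ x, w t0 x = 0)
    (hgood : ∀ c d, a < c → c ≤ d → d < b → ∀ t1 ∈ Icc 0 T, ∃ C, ∀ t ∈ Icc 0 T,
      ∫ x in c..d, ‖w t x - w t1 x‖^2 ≤ C * (t - t1)^2)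
    (t : ℝ) (ht : t ∈ Icc 0 T) :
    ∫ x in a..b, ‖w t x‖^2 ≤ 4 * K^2 * (b - a) * (t - t0)^2 := by
  have hws : ∀ s, Continuous (w s) := fun s => hw.comp (Continuous.prodMk_right s)
  rcases eq_or_ne t t0 with rfl | hne
  · simp [h0]
  set τ := |t - t0| with hτ
  have hτpos : 0 < τ := abs_pos.2 (sub_ne_zero.2 hne)
  have hJ : uIcc t0 t ⊆ Icc 0 T := uIcc_subset_Icc ht0 ht
  have hJτ : ∀ s ∈ uIcc t0 t, |s - t0| ≤ τ := fun s hs => abs_sub_left_of_mem_uIcc hs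
  set φ : ℝ → ℝ → ℝ := fun s x => (Complex.I * ((starRingEnd ℂ) (w s x) * wx s x)).re with hφ
  have hφc : Continuous (Function.uncurry φ) :=
    Complex.continuous_re.comp (continuous_const.mul ((Complex.continuous_conj.comp hw).mul hwx))
  -- interior estimate
  have key : ∀ c d E, a < c → c ≤ d → d < b → (∀ s ∈ uIcc t0 t, |φ s c| ≤ E) →
      (∀ s ∈ uIcc t0 t, |φ s d| ≤ E) →
      ∫ x in c..d, ‖w t x‖^2 ≤ 4 * τ * E + 4 * K^2 * (b - a) * τ^2 := by
    intro c d E hac hcd hdb hEc hEd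
    set q : ℝ → ℝ := fun s => ∫ x in c..d, ‖w s x‖^2 with hq
    have hqc : Continuous q := by
      apply intervalIntegral.continuous_parametric_intervalIntegral_of_continuous'
      exact hw.norm.pow 2
    obtain ⟨s1, hs1, hmax⟩ := isCompact_uIcc.exists_isMaxOn (s := uIcc t0 t) ⟨t0, left_mem_uIcc⟩
      hqc.continuousOn
    have hder : ∀ s ∈ uIcc t0 t, HasDerivWithinAt q
        (∫ x in c..d, 2 * ((starRingEnd ℂ) (w s x) * wt s x).re) (uIcc t0 t) s := by
      intro s hs
      obtain ⟨C, hC⟩ := hgood c d hac hcd hdb s (hJ hs)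
      exact (aux_deriv w (wt s) T c d C s hcd hw (hwt s) (hJ hs) (hdt s (hJ hs)) hC).mono hJ
    have hbound : ∀ s ∈ uIcc t0 t, ‖∫ x in c..d, 2 * ((starRingEnd ℂ) (w s x) * wt s x).re‖
        ≤ 2 * E + 2 * K^2 * τ * (b - a) + q s1 / (2 * τ) := by
      intro s hsJ
      have hc1 : Continuous fun x => (Complex.I * ((starRingEnd ℂ) (w s x) * wxx s x)).re :=
        Complex.continuous_re.comp
          (continuous_const.mul ((Complex.continuous_conj.comp (hws s)).mul (hwxx s)))
      have hc2 : Continuous fun x => 2 * ((starRingEnd ℂ) (w s x) *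
          (wt s x - Complex.I / 2 * wxx s x)).re :=
        continuous_const.mul (Complex.continuous_re.comp
          ((Complex.continuous_conj.comp (hws s)).mul ((hwt s).sub (continuous_const.mul (hwxx s)))))
      have e1 : (∫ x in c..d, 2 * ((starRingEnd ℂ) (w s x) * wt s x).re)
          = (∫ x in c..d, (Complex.I * ((starRingEnd ℂ) (w s x) * wxx s x)).re)
          + ∫ x in c..d, 2 * ((starRingEnd ℂ) (w s x) * (wt s x - Complex.I / 2 * wxx s x)).re := by
        rw [← intervalIntegral.integral_add (hc1.intervalIntegrable _ _)
          (hc2.intervalIntegrable _ _)]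
        congr 1
        ext x
        simp only [Complex.mul_re, Complex.mul_im, Complex.sub_re, Complex.sub_im, Complex.I_re,
          Complex.I_im, Complex.conj_re, Complex.conj_im, Complex.div_ofNat_re,
          Complex.div_ofNat_im]
        ring
      rw [e1, aux_parts (w s) (wx s) (wxx s) c d (hd1 s) (hd2 s) (hwxx s)]
      have hc3 : Continuous fun x => 2 * K^2 * τ + ‖w s x‖^2 / (2 * τ) :=
        continuous_const.add (((hws s).norm.pow 2).div_const _)
      have e2 : |∫ x in c..d, 2 * ((starRingEnd ℂ) (w s x) *
          (wt s x - Complex.I / 2 * wxx s x)).re|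
          ≤ ∫ x in c..d, (2 * K^2 * τ + ‖w s x‖^2 / (2 * τ)) := by
        refine (intervalIntegral.abs_integral_le_integral_abs hcd).trans ?_
        apply intervalIntegral.integral_mono_on hcd (hc2.abs.intervalIntegrable _ _)
          (hc3.intervalIntegrable _ _)
        intro x hx
        have f1 := hs s (hJ hsJ) x ⟨hac.le.trans hx.1, hx.2.trans hdb.le⟩
        have f2 := Complex.abs_re_le_norm ((starRingEnd ℂ) (w s x) *
          (wt s x - Complex.I / 2 * wxx s x))
        rw [norm_mul, RCLike.norm_conj] at f2
        have f3 : ‖w s x‖ * ‖wt s x - Complex.I / 2 * wxx s x‖ ≤ ‖w s x‖ * K := by gcongr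
        rw [abs_mul, abs_two]
        have f4 : 2 * (‖w s x‖ * K) ≤ 2 * K^2 * τ + ‖w s x‖^2 / (2 * τ) := by
          rw [← sub_nonneg]
          have : 2 * K^2 * τ + ‖w s x‖^2 / (2 * τ) - 2 * (‖w s x‖ * K)
            = (2 * K * τ - ‖w s x‖)^2 / (2 * τ) := by field_simp; ring
          rw [this]; positivity
        linarith
      have hi1 : IntervalIntegrable (fun x => ‖w s x‖^2 / (2 * τ)) volume c d :=
        (((hws s).norm.pow 2).div_const _).intervalIntegrable _ _
      rw [intervalIntegral.integral_add intervalIntegrable_const hi1,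
        intervalIntegral.integral_div, intervalIntegral.integral_const, smul_eq_mul] at e2
      have e3 : q s / (2 * τ) ≤ q s1 / (2 * τ) := by
        gcongr
        exact hmax hsJ
      have e4 : (d - c) * (2 * K^2 * τ) ≤ (b - a) * (2 * K^2 * τ) := by
        gcongr
      have e5 := hEc s hsJ
      have e6 := hEd s hsJ
      rw [Real.norm_eq_abs]
      have e7 := abs_add_le (φ s d - φ s c) (∫ x in c..d, 2 * ((starRingEnd ℂ) (w s x) *
          (wt s x - Complex.I / 2 * wxx s x)).re)
      have e8 := abs_sub (φ s d) (φ s c)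
      have e9 : (∫ x in c..d, ‖w s x‖^2) / (2 * τ) = q s / (2 * τ) := rfl
      have e10 : |φ s d - φ s c| ≤ |φ s d| + |φ s c| := by
        rw [sub_eq_add_neg]; exact (abs_add_le _ _).trans (by rw [abs_neg])
      simp only [hφ] at *
      linarith
    have hmv := (convex_uIcc t0 t).norm_image_sub_le_of_norm_hasDerivWithin_le hder hbound
      left_mem_uIcc hs1
    have hq0 : q t0 = 0 := by simp [hq, h0]
    rw [hq0, sub_zero, Real.norm_eq_abs, Real.norm_eq_abs] at hmv
    have hq1 : 0 ≤ q s1 := intervalIntegral.integral_nonneg hcd (fun x _ => by positivity)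
    have hE0 : 0 ≤ E := (abs_nonneg _).trans (hEc t0 left_mem_uIcc)
    have hba : 0 < b - a := sub_pos.2 hab
    have hmv2 : q s1 ≤ (2 * E + 2 * K^2 * τ * (b - a) + q s1 / (2 * τ)) * τ := by
      refine (le_abs_self _).trans (hmv.trans ?_)
      gcongr
      exact hJτ s1 hs1
    have : (2 * E + 2 * K^2 * τ * (b - a) + q s1 / (2 * τ)) * τ
        = 2 * E * τ + 2 * K^2 * τ^2 * (b - a) + q s1 / 2 := by field_simp
    rw [this] at hmv2
    have hqt : q t ≤ q s1 := hmax right_mem_uIcc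
    have : (∫ x in c..d, ‖w t x‖^2) = q t := rfl
    linarith
  rw [← sq_abs (t - t0), ← hτ]
  apply le_of_forall_pos_le_add
  intro ε hε
  set E := ε / (4 * τ) with hE
  have hEpos : 0 < E := by positivity
  have hend : ∀ y, (∀ s, w s y = 0) → ∀ᶠ x in 𝓝 y, ∀ s ∈ uIcc t0 t, |φ s x| ≤ E := by
    intro y hy
    apply isCompact_uIcc.eventually_forall_of_forall_eventually
    intro s _
    have hcont : Continuous (fun z : ℝ × ℝ => |φ z.2 z.1|) :=
      (hφc.comp continuous_swap).abs
    have : |φ s y| < E := by simp [hφ, hy s, hEpos]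
    have h3 := (hcont.tendsto (y, s)).eventually_lt_const this
    exact h3.mono fun z hz => le_of_lt hz
  have hta : Tendsto (fun η : ℝ => a + η) (𝓝[>] 0) (𝓝 a) := by
    have : Tendsto (fun η : ℝ => a + η) (𝓝 0) (𝓝 (a + 0)) := by
      exact (continuous_const.add continuous_id).tendsto 0
    rw [add_zero] at this
    exact this.mono_left nhdsWithin_le_nhds
  have htb : Tendsto (fun η : ℝ => b - η) (𝓝[>] 0) (𝓝 b) := by
    have : Tendsto (fun η : ℝ => b - η) (𝓝 0) (𝓝 (b - 0)) := by
      exact (continuous_const.sub continuous_id).tendsto 0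
    rw [sub_zero] at this
    exact this.mono_left nhdsWithin_le_nhds
  have hlim : Tendsto (fun η : ℝ => ∫ x in (a + η)..(b - η), ‖w t x‖^2) (𝓝[>] 0)
      (𝓝 (∫ x in a..b, ‖w t x‖^2)) := by
    have hi : ∀ u v, IntervalIntegrable (fun x => ‖w t x‖^2) volume u v := fun u v =>
      ((hws t).norm.pow 2).intervalIntegrable _ _
    have hp : Continuous fun u => ∫ x in a..u, ‖w t x‖^2 :=
      intervalIntegral.continuous_primitive hi a
    have h1 := ((hp.tendsto b).comp htb).sub ((hp.tendsto a).comp hta)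
    simp only [intervalIntegral.integral_same, sub_zero] at h1
    refine h1.congr fun η => ?_
    simp only [Function.comp]
    exact intervalIntegral.integral_interval_sub_left (hi _ _) (hi _ _)
  refine le_of_tendsto hlim ?_
  have hsmall : ∀ᶠ η : ℝ in 𝓝[>] 0, η < (b - a) / 2 :=
    nhdsWithin_le_nhds (eventually_lt_nhds (by linarith))
  filter_upwards [hta.eventually (hend a ha), htb.eventually (hend b hb), hsmall,
    self_mem_nhdsWithin] with η e1 e2 e3 e4
  have e4' : 0 < η := e4
  have := key (a + η) (b - η) E (by linarith) (by linarith) (by linarith) e1 e2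
  have h5 : 4 * τ * E = ε := by rw [hE]; field_simp
  linarith

structure AuxSetup (T : ℝ) (ψ ψt ψx ψxx S : ℝ → ℝ → ℂ) : Prop where
  cψ : Continuous (Function.uncurry ψ)
  cx : Continuous (Function.uncurry ψx)
  cS : Continuous (Function.uncurry S)
  ct : ∀ x, Continuous (fun t => ψt t x)
  cxx : ∀ t, Continuous (ψxx t)
  d1 : ∀ t x, HasDerivAt (ψ t) (ψx t x) x
  d2 : ∀ t x, HasDerivAt (ψx t) (ψxx t x) x
  dt : ∀ t ∈ Icc 0 T, ∀ x, HasDerivWithinAt (fun s => ψ s x) (ψt t x) (Icc 0 T) t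
  eq : ∀ t x, ψt t x = Complex.I / 2 * ψxx t x + S t x

lemma AuxSetup.cψs {T : ℝ} {ψ ψt ψx ψxx S : ℝ → ℝ → ℂ} (H : AuxSetup T ψ ψt ψx ψxx S) (t : ℝ) :
    Continuous (ψ t) := H.cψ.comp (Continuous.prodMk_right t)

lemma AuxSetup.ctx {T : ℝ} {ψ ψt ψx ψxx S : ℝ → ℝ → ℂ} (H : AuxSetup T ψ ψt ψx ψxx S) (t : ℝ) :
    Continuous (ψt t) := by
  have : ψt t = fun x => Complex.I / 2 * ψxx t x + S t x := funext (H.eq t)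
  rw [this]
  exact (continuous_const.mul (H.cxx t)).add (H.cS.comp (Continuous.prodMk_right t))

lemma AuxSetup.lip {T : ℝ} {ψ ψt ψx ψxx S : ℝ → ℝ → ℂ} (H : AuxSetup T ψ ψt ψx ψxx S) {n x : ℝ}
    (hn : ∀ t ∈ Icc 0 T, ‖ψt t x‖ ≤ n) {s t : ℝ} (hs : s ∈ Icc 0 T) (ht : t ∈ Icc 0 T) :
    ‖ψ t x - ψ s x‖ ≤ n * |t - s| :=
  (convex_Icc 0 T).norm_image_sub_le_of_norm_hasDerivWithin_le
    (fun t ht => H.dt t ht x) hn hs ht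

lemma aux_conv (A B : ℂ) (θ m : ℝ) (hA : ‖A‖ ≤ m) (hB : ‖B‖ ≤ m) (h0 : 0 ≤ θ) (h1 : θ ≤ 1) :
    ‖A * (θ : ℂ) + B * ((1 - θ : ℝ) : ℂ)‖ ≤ m := by
  refine (norm_add_le _ _).trans ?_
  rw [norm_mul, norm_mul, Complex.norm_real, Complex.norm_real, Real.norm_of_nonneg h0,
    Real.norm_of_nonneg (sub_nonneg.2 h1)]
  nlinarith

lemma aux_sq (A B : ℂ) (m : ℝ) (hB : ‖B‖ ≤ m) : ‖A + B‖^2 ≤ 2 * ‖A‖^2 + 2 * m^2 := by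
  have h1 := norm_add_le A B
  have h2 : ‖A + B‖^2 ≤ (‖A‖ + m)^2 := by gcongr; linarith
  nlinarith [sq_nonneg (‖A‖ - m)]

set_option maxHeartbeats 2000000 in
lemma aux_gap {T : ℝ} {ψ ψt ψx ψxx S : ℝ → ℝ → ℂ} (H : AuxSetup T ψ ψt ψx ψxx S)
    (a b n K1 K2 t0 : ℝ) (hab : a < b) (ht0 : t0 ∈ Icc 0 T)
    (hna : ∀ t ∈ Icc 0 T, ‖ψt t a‖ ≤ n) (hnb : ∀ t ∈ Icc 0 T, ‖ψt t b‖ ≤ n)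
    (hK1 : ∀ x ∈ Icc a b, ‖ψxx t0 x‖ ≤ K1)
    (hK2 : ∀ t ∈ Icc 0 T, ∀ x ∈ Icc a b, ‖S t x‖ ≤ K2)
    (hgood : ∀ c d, a < c → c ≤ d → d < b → ∀ t1 ∈ Icc 0 T, ∃ C, ∀ t ∈ Icc 0 T,
      ∫ x in c..d, ‖ψ t x - ψ t1 x‖^2 ≤ C * (t - t1)^2)
    (t : ℝ) (ht : t ∈ Icc 0 T) :
    ∫ x in a..b, ‖ψ t x - ψ t0 x‖^2
      ≤ (8 * (K1 / 2 + K2 + n)^2 + 2 * n^2) * (b - a) * (t - t0)^2 := by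
  have hba : 0 < b - a := sub_pos.2 hab
  set θ : ℝ → ℝ := fun x => (b - x) / (b - a) with hθ
  have hθa : θ a = 1 := by simp [hθ, hba.ne']
  have hθb : θ b = 0 := by simp [hθ]
  have hθ0 : ∀ x ∈ Icc a b, 0 ≤ θ x := fun x hx => div_nonneg (sub_nonneg.2 hx.2) hba.le
  have hθ1 : ∀ x ∈ Icc a b, θ x ≤ 1 := fun x hx => by
    rw [hθ]; simp only; rw [div_le_one hba]; linarith [hx.1]
  have hθd : ∀ x, HasDerivAt θ (-1 / (b - a)) x := fun x =>
    ((hasDerivAt_id x).const_sub b).div_const _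
  have hθc : Continuous θ := (continuous_const.sub continuous_id).div_const _
  set ℓ : ℝ → ℝ → ℂ := fun s x => (ψ s a - ψ t0 a) * (θ x : ℂ)
    + (ψ s b - ψ t0 b) * ((1 - θ x : ℝ) : ℂ) with hℓ
  set ℓt : ℝ → ℝ → ℂ := fun s x => ψt s a * (θ x : ℂ) + ψt s b * ((1 - θ x : ℝ) : ℂ) with hℓt
  set w : ℝ → ℝ → ℂ := fun s x => ψ s x - ψ t0 x - ℓ s x with hw
  set wx : ℝ → ℝ → ℂ := fun s x => ψx s x - ψx t0 x
    - ((ψ s a - ψ t0 a) * ((-1 / (b - a) : ℝ) : ℂ)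
      + (ψ s b - ψ t0 b) * ((- (-1 / (b - a)) : ℝ) : ℂ)) with hwx
  have hcy : ∀ y, Continuous fun p : ℝ × ℝ => ψ p.1 y := fun y =>
    H.cψ.comp (continuous_fst.prodMk continuous_const)
  have hct0 : Continuous fun p : ℝ × ℝ => ψ t0 p.2 := (H.cψs t0).comp continuous_snd
  have hcx0 : Continuous fun p : ℝ × ℝ => ψx t0 p.2 :=
    H.cx.comp (continuous_const.prodMk continuous_snd)
  have hcψ : Continuous fun p : ℝ × ℝ => ψ p.1 p.2 := H.cψ
  have hcψx : Continuous fun p : ℝ × ℝ => ψx p.1 p.2 := H.cx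
  have cw : Continuous (Function.uncurry w) := by
    have h1 : Continuous fun p : ℝ × ℝ => ((θ p.2 : ℝ) : ℂ) :=
      Complex.continuous_ofReal.comp (hθc.comp continuous_snd)
    have h2 : Continuous fun p : ℝ × ℝ => ((1 - θ p.2 : ℝ) : ℂ) :=
      Complex.continuous_ofReal.comp (continuous_const.sub (hθc.comp continuous_snd))
    exact (hcψ.sub hct0).sub ((((hcy a).sub continuous_const).mul h1).add
      (((hcy b).sub continuous_const).mul h2))
  have cwx : Continuous (Function.uncurry wx) :=
    (hcψx.sub hcx0).sub ((((hcy a).sub continuous_const).mul continuous_const).add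
      (((hcy b).sub continuous_const).mul continuous_const))
  have cwt : ∀ s, Continuous (fun x => ψt s x - ℓt s x) := fun s =>
    (H.ctx s).sub ((continuous_const.mul (Complex.continuous_ofReal.comp hθc)).add
      (continuous_const.mul (Complex.continuous_ofReal.comp (continuous_const.sub hθc))))
  have hlipab : ∀ s ∈ Icc 0 T, ∀ s' ∈ Icc 0 T, ∀ x ∈ Icc a b, ‖ℓ s x - ℓ s' x‖ ≤ n * |s - s'| := by
    intro s hs s' hs' x hx
    have : ℓ s x - ℓ s' x = (ψ s a - ψ s' a) * (θ x : ℂ)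
      + (ψ s b - ψ s' b) * ((1 - θ x : ℝ) : ℂ) := by simp only [hℓ]; ring
    rw [this]
    exact aux_conv _ _ _ _ (H.lip hna hs' hs) (H.lip hnb hs' hs) (hθ0 x hx) (hθ1 x hx)
  have hE := aux_energy T a b (K1 / 2 + K2 + n) t0 hab ht0 w wx
    (fun s x => ψxx s x - ψxx t0 x) (fun s x => ψt s x - ℓt s x) cw cwx
    (fun s => (H.cxx s).sub (H.cxx t0)) cwt
    (by
      intro s x
      have h1 : HasDerivAt (fun y => ((θ y : ℝ) : ℂ)) ((-1 / (b - a) : ℝ) : ℂ) x :=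
        (hθd x).ofReal_comp
      have h2 : HasDerivAt (fun y => ((1 - θ y : ℝ) : ℂ)) ((-(-1 / (b - a)) : ℝ) : ℂ) x :=
        ((hθd x).const_sub 1).ofReal_comp
      exact ((H.d1 s x).sub (H.d1 t0 x)).sub ((h1.const_mul _).add (h2.const_mul _)))
    (by
      intro s x
      exact ((H.d2 s x).sub (H.d2 t0 x)).sub_const _)
    (by
      intro s hs x
      exact ((H.dt s hs x).sub_const _).sub ((((H.dt s hs a).sub_const _).mul_const _).add
        (((H.dt s hs b).sub_const _).mul_const _)))
    (by
      intro s hs x hx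
      have e : ψt s x - ℓt s x - Complex.I / 2 * (ψxx s x - ψxx t0 x)
          = Complex.I / 2 * ψxx t0 x + S s x - ℓt s x := by rw [H.eq s x]; ring
      rw [e]
      have f1 : ‖ℓt s x‖ ≤ n :=
        aux_conv _ _ _ _ (hna s hs) (hnb s hs) (hθ0 x hx) (hθ1 x hx)
      have f2 : ‖Complex.I / 2 * ψxx t0 x‖ ≤ K1 / 2 := by
        rw [norm_mul]
        have : ‖Complex.I / 2‖ = 1 / 2 := by simp
        rw [this]; linarith [hK1 x hx]
      have f3 := hK2 s hs x hx
      have f4 := norm_sub_le (Complex.I / 2 * ψxx t0 x + S s x) (ℓt s x)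
      have f5 := norm_add_le (Complex.I / 2 * ψxx t0 x) (S s x)
      linarith)
    (by intro s; simp [hw, hℓ, hθa]) (by intro s; simp [hw, hℓ, hθb]) (by intro x; simp [hw, hℓ])
    (by
      intro c d hac hcd hdb t1 ht1
      obtain ⟨C, hC⟩ := hgood c d hac hcd hdb t1 ht1
      refine ⟨2 * C + 2 * n^2 * (d - c), fun s hs => ?_⟩
      have hc1 : Continuous fun x => ‖ψ s x - ψ t1 x‖^2 :=
        ((H.cψs s).sub (H.cψs t1)).norm.pow 2
      have hc2 : Continuous fun x => ‖w s x - w t1 x‖^2 :=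
        ((cw.comp (Continuous.prodMk_right s)).sub (cw.comp (Continuous.prodMk_right t1))).norm.pow 2
      have hi : IntervalIntegrable (fun x => 2 * ‖ψ s x - ψ t1 x‖^2) volume c d :=
        (continuous_const.mul hc1).intervalIntegrable _ _
      have hle : (∫ x in c..d, ‖w s x - w t1 x‖^2)
          ≤ ∫ x in c..d, (2 * ‖ψ s x - ψ t1 x‖^2 + 2 * (n * |s - t1|)^2) := by
        apply intervalIntegral.integral_mono_on hcd (hc2.intervalIntegrable _ _)
          (hi.add intervalIntegrable_const)
        intro x hx
        have hx' : x ∈ Icc a b := ⟨hac.le.trans hx.1, hx.2.trans hdb.le⟩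
        have e : w s x - w t1 x = (ψ s x - ψ t1 x) + (-(ℓ s x - ℓ t1 x)) := by
          simp only [hw]; ring
        rw [e]
        exact aux_sq _ _ _ (by rw [norm_neg]; exact hlipab s hs t1 ht1 x hx')
      rw [intervalIntegral.integral_add hi intervalIntegrable_const,
        intervalIntegral.integral_const_mul, intervalIntegral.integral_const, smul_eq_mul,
        mul_pow, sq_abs] at hle
      have := hC s hs
      nlinarith)
    t ht
  have hc1 : Continuous fun x => ‖ψ t x - ψ t0 x‖^2 := ((H.cψs t).sub (H.cψs t0)).norm.pow 2
  have hc2 : Continuous fun x => ‖w t x‖^2 := (cw.comp (Continuous.prodMk_right t)).norm.pow 2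
  have hi : IntervalIntegrable (fun x => 2 * ‖w t x‖^2) volume a b :=
    (continuous_const.mul hc2).intervalIntegrable _ _
  have hle : (∫ x in a..b, ‖ψ t x - ψ t0 x‖^2)
      ≤ ∫ x in a..b, (2 * ‖w t x‖^2 + 2 * (n * |t - t0|)^2) := by
    apply intervalIntegral.integral_mono_on hab.le (hc1.intervalIntegrable _ _)
      (hi.add intervalIntegrable_const)
    intro x hx
    have e0 : ℓ t0 x = 0 := by simp [hℓ]
    have e : ψ t x - ψ t0 x = w t x + ℓ t x := by simp only [hw]; ring
    rw [e]
    refine aux_sq _ _ _ ?_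
    have := hlipab t ht t0 ht0 x hx
    rwa [e0, sub_zero] at this
  rw [intervalIntegral.integral_add hi intervalIntegrable_const,
    intervalIntegral.integral_const_mul, intervalIntegral.integral_const, smul_eq_mul,
    mul_pow, sq_abs] at hle
  linarith

lemma AuxSetup.cSs {T : ℝ} {ψ ψt ψx ψxx S : ℝ → ℝ → ℂ} (H : AuxSetup T ψ ψt ψx ψxx S) (t : ℝ) :
    Continuous (S t) := H.cS.comp (Continuous.prodMk_right t)

def AuxGood (T : ℝ) (ψ : ℝ → ℝ → ℂ) (s : Set ℝ) : Prop :=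
  ∀ t0 ∈ Icc 0 T, ∃ C : NNReal, ∀ t ∈ Icc 0 T,
    ∫⁻ x in s, ENNReal.ofReal (‖ψ t x - ψ t0 x‖^2) ≤ C * ENNReal.ofReal ((t - t0)^2)

lemma AuxGood.mono {T : ℝ} {ψ : ℝ → ℝ → ℂ} {s s' : Set ℝ} (h : s ⊆ s') (hg : AuxGood T ψ s') :
    AuxGood T ψ s := fun t0 ht0 => by
  obtain ⟨C, hC⟩ := hg t0 ht0
  exact ⟨C, fun t ht => (lintegral_mono_set h).trans (hC t ht)⟩

lemma AuxGood.union {T : ℝ} {ψ : ℝ → ℝ → ℂ} {s s' : Set ℝ} (h : AuxGood T ψ s)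
    (h' : AuxGood T ψ s') : AuxGood T ψ (s ∪ s') := fun t0 ht0 => by
  obtain ⟨C, hC⟩ := h t0 ht0
  obtain ⟨C', hC'⟩ := h' t0 ht0
  refine ⟨C + C', fun t ht => (lintegral_union_le _ _ _).trans ?_⟩
  rw [ENNReal.coe_add, add_mul]
  exact add_le_add (hC t ht) (hC' t ht)

lemma AuxGood.of_compact {T : ℝ} {ψ : ℝ → ℝ → ℂ} {K : Set ℝ} (hK : IsCompact K)
    (h : ∀ x ∈ K, ∃ V ∈ 𝓝 x, AuxGood T ψ V) : AuxGood T ψ K := by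
  refine hK.induction_on (p := AuxGood T ψ) ?_ (fun s t hst h => h.mono hst)
    (fun s t hs ht => hs.union ht) ?_
  · intro t0 _; exact ⟨0, fun t _ => by simp⟩
  · intro x hx
    obtain ⟨V, hV, hg⟩ := h x hx
    exact ⟨V, mem_nhdsWithin_of_mem_nhds hV, hg⟩

lemma aux_conv_int (f : ℝ → ℝ) (hf : Continuous f) (h0 : ∀ x, 0 ≤ f x) (c d : ℝ) (hcd : c ≤ d) :
    ∫⁻ x in Ioo c d, ENNReal.ofReal (f x) = ENNReal.ofReal (∫ x in c..d, f x) := by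
  rw [intervalIntegral.integral_of_le hcd, setLIntegral_congr Ioo_ae_eq_Ioc,
    ofReal_integral_eq_lintegral_ofReal]
  · exact (hf.intervalIntegrable c d).1
  · exact Eventually.of_forall h0

lemma AuxGood.integral {T : ℝ} {ψ ψt ψx ψxx S : ℝ → ℝ → ℂ} (H : AuxSetup T ψ ψt ψx ψxx S)
    {c d : ℝ} (hcd : c ≤ d) (h : AuxGood T ψ (Icc c d)) :
    ∀ t1 ∈ Icc 0 T, ∃ C, ∀ t ∈ Icc 0 T,
      ∫ x in c..d, ‖ψ t x - ψ t1 x‖^2 ≤ C * (t - t1)^2 := by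
  intro t1 ht1
  obtain ⟨C, hC⟩ := h.mono Ioo_subset_Icc_self t1 ht1
  refine ⟨C, fun t ht => ?_⟩
  have := hC t ht
  rw [aux_conv_int (fun x => ‖ψ t x - ψ t1 x‖^2) (((H.cψs t).sub (H.cψs t1)).norm.pow 2)
    (fun x => by positivity) c d hcd,
    ← ENNReal.ofReal_coe_nnreal, ← ENNReal.ofReal_mul (NNReal.coe_nonneg C),
    ENNReal.ofReal_le_ofReal_iff (by positivity)] at this
  exact this

set_option maxHeartbeats 2000000 in
lemma aux_baire {T : ℝ} {ψ ψt ψx ψxx S : ℝ → ℝ → ℂ} (H : AuxSetup T ψ ψt ψx ψxx S) (x : ℝ) :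
    ∃ V ∈ 𝓝 x, AuxGood T ψ V := by
  set U : Set ℝ := {x | ∃ V ∈ 𝓝 x, AuxGood T ψ V} with hU
  have hUo : IsOpen U := by
    rw [isOpen_iff_mem_nhds]
    rintro y ⟨V, hV, hg⟩
    filter_upwards [eventually_mem_nhds_iff.2 hV] with z hz
    exact ⟨V, hz, hg⟩
  by_contra hx
  have hcl : IsClosed Uᶜ := hUo.isClosed_compl
  have : CompleteSpace (Uᶜ : Set ℝ) := hcl.completeSpace_coe
  have : Nonempty (Uᶜ : Set ℝ) := ⟨⟨x, hx⟩⟩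
  have hbdd : ∀ y, ∃ n : ℝ, ∀ t ∈ Icc 0 T, ‖ψt t y‖ ≤ n := fun y =>
    isCompact_Icc.exists_bound_of_continuousOn (H.ct y).continuousOn
  obtain ⟨N, hN⟩ := nonempty_interior_of_iUnion_of_closed
    (f := fun n : ℕ => {y : (Uᶜ : Set ℝ) | ∀ t ∈ Icc 0 T, ‖ψt t y‖ ≤ n})
    (by
      intro n
      simp only [ofPred_forall]
      refine isClosed_iInter fun t => isClosed_iInter fun _ => ?_
      exact isClosed_le ((H.ctx t).comp continuous_subtype_val).norm continuous_const)
    (by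
      rw [eq_univ_iff_forall]
      intro y
      obtain ⟨n, hn⟩ := hbdd y
      obtain ⟨m, hm⟩ := exists_nat_ge n
      exact mem_iUnion.2 ⟨m, fun t ht => (hn t ht).trans hm⟩)
  obtain ⟨x0, hx0⟩ := hN
  rw [mem_interior_iff_mem_nhds, Metric.mem_nhds_iff] at hx0
  obtain ⟨ε, hε, hball⟩ := hx0
  set i0 := (x0 : ℝ) - ε / 2 with hi0
  set i1 := (x0 : ℝ) + ε / 2 with hi1
  obtain ⟨n0, hn0⟩ := hbdd i0
  obtain ⟨n1, hn1⟩ := hbdd i1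
  set n : ℝ := max N (max n0 n1) with hn
  have hnn : 0 ≤ n := (Nat.cast_nonneg N).trans (le_max_left _ _)
  have hF : ∀ y ∈ Icc i0 i1, y ∉ U ∩ Ioo i0 i1 → ∀ t ∈ Icc 0 T, ‖ψt t y‖ ≤ n := by
    intro y hy hyU t ht
    rcases eq_or_lt_of_le hy.1 with h | h
    · rw [← h]; exact (hn0 t ht).trans ((le_max_left _ _).trans (le_max_right _ _))
    rcases eq_or_lt_of_le hy.2 with h' | h'
    · rw [h']; exact (hn1 t ht).trans ((le_max_right _ _).trans (le_max_right _ _))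
    have hyU' : y ∉ U := fun hu => hyU ⟨hu, h, h'⟩
    have : (⟨y, hyU'⟩ : (Uᶜ : Set ℝ)) ∈ Metric.ball x0 ε := by
      rw [Metric.mem_ball, Subtype.dist_eq, Real.dist_eq, abs_lt]
      constructor <;> simp only <;> linarith
    exact (hball this t ht).trans (le_max_left _ _)
  have hi01 : i0 < i1 := by linarith
  apply x0.2
  refine ⟨Ioo i0 i1, Ioo_mem_nhds (by linarith) (by linarith), ?_⟩
  have hsplit : Ioo i0 i1 ⊆ (Ioo i0 i1 \ U) ∪ (U ∩ Ioo i0 i1) := by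
    intro y hy
    by_cases h : y ∈ U
    · exact Or.inr ⟨h, hy⟩
    · exact Or.inl ⟨hy, h⟩
  refine AuxGood.mono hsplit (AuxGood.union ?_ ?_)
  · intro t0 ht0
    refine ⟨Real.toNNReal (n^2 * (i1 - i0)), fun t ht => ?_⟩
    have hle : ∫⁻ y in Ioo i0 i1 \ U, ENNReal.ofReal (‖ψ t y - ψ t0 y‖^2)
        ≤ ∫⁻ y in Ioo i0 i1 \ U, ENNReal.ofReal (n^2 * (t - t0)^2) := by
      apply setLIntegral_mono' (measurableSet_Ioo.diff hUo.measurableSet)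
      intro y hy
      apply ENNReal.ofReal_le_ofReal
      have := H.lip (hF y (Ioo_subset_Icc_self hy.1) (fun h => hy.2 h.1)) ht0 ht
      rw [← sq_abs (t - t0), ← mul_pow]
      gcongr
    refine hle.trans ?_
    refine (lintegral_mono_set sdiff_subset).trans ?_
    rw [setLIntegral_const, Real.volume_Ioo, ← ENNReal.ofReal_mul (by positivity),
      ← ENNReal.ofReal_coe_nnreal, ← ENNReal.ofReal_mul (NNReal.coe_nonneg _)]
    apply ENNReal.ofReal_le_ofReal
    have hi := sub_pos.2 hi01
    rw [Real.coe_toNNReal _ (by positivity)]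
    linarith
  · intro t0 ht0
    obtain ⟨K1, hK1⟩ := (isCompact_Icc (a := i0) (b := i1)).exists_bound_of_continuousOn
      (H.cxx t0).continuousOn
    obtain ⟨K2, hK2⟩ := ((isCompact_Icc (a := 0) (b := T)).prod
      (isCompact_Icc (a := i0) (b := i1))).exists_bound_of_continuousOn H.cS.continuousOn
    set A : ℝ := 8 * (K1 / 2 + K2 + n)^2 + 2 * n^2 with hA
    have hA0 : 0 ≤ A := by positivity
    refine ⟨Real.toNNReal (A * (i1 - i0)), fun t ht => ?_⟩
    have hcomp := aux_components (U ∩ Ioo i0 i1) (hUo.inter isOpen_Ioo) i0 i1 inter_subset_right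
      (fun y => ENNReal.ofReal (‖ψ t y - ψ t0 y‖^2)) (ENNReal.ofReal (A * (t - t0)^2))
      (by
        intro a b hab ha hb haV hbV hsub
        rw [aux_conv_int (fun x => ‖ψ t x - ψ t0 x‖^2) (((H.cψs t).sub (H.cψs t0)).norm.pow 2)
          (fun x => by positivity) a b
          hab.le, Real.volume_Ioo, ← ENNReal.ofReal_mul (by positivity)]
        apply ENNReal.ofReal_le_ofReal
        have hIcc : Icc a b ⊆ Icc i0 i1 := Icc_subset_Icc ha.1 hb.2
        have := aux_gap H a b n K1 K2 t0 hab ht0 (hF a ha haV) (hF b hb hbV)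
          (fun y hy => hK1 y (hIcc hy)) (fun s hs y hy => hK2 (s, y) ⟨hs, hIcc hy⟩)
          (by
            intro c d hac hcd hdb
            refine AuxGood.integral H hcd (AuxGood.of_compact isCompact_Icc ?_)
            intro y hy
            exact (hsub ⟨hac.trans_le hy.1, hy.2.trans_lt hdb⟩).1)
          t ht
        rw [← hA] at this
        refine this.trans (le_of_eq ?_)
        ring)
    refine hcomp.trans ?_
    have hvol : volume (U ∩ Ioo i0 i1) ≤ ENNReal.ofReal (i1 - i0) := by
      rw [← Real.volume_Ioo]; exact measure_mono inter_subset_right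
    refine (mul_le_mul_right hvol _).trans ?_
    rw [← ENNReal.ofReal_mul (by positivity),
      ← ENNReal.ofReal_coe_nnreal, ← ENNReal.ofReal_mul (NNReal.coe_nonneg _)]
    apply ENNReal.ofReal_le_ofReal
    have hi := sub_pos.2 hi01
    rw [Real.coe_toNNReal _ (by positivity)]
    linarith

lemma aux_mass_deriv {T : ℝ} {ψ ψt ψx ψxx S : ℝ → ℝ → ℂ} (H : AuxSetup T ψ ψt ψx ψxx S)
    (L : ℝ) (hL : 0 ≤ L) (t : ℝ) (ht : t ∈ Icc 0 T) (h0 : ψ t L = ψ t 0) (h1 : ψx t L = ψx t 0) :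
    HasDerivWithinAt (fun t => ∫ x in (0:ℝ)..L, ‖ψ t x‖^2)
      (∫ x in (0:ℝ)..L, 2 * ((starRingEnd ℂ) (ψ t x) * S t x).re) (Icc 0 T) t := by
  obtain ⟨C, hC⟩ := AuxGood.integral H hL
    (AuxGood.of_compact isCompact_Icc fun x _ => aux_baire H x) t ht
  have hd := aux_deriv ψ (ψt t) T 0 L C t hL H.cψ (H.ctx t) ht (H.dt t ht) hC
  refine hd.congr_deriv ?_
  have hS : Continuous (S t) := H.cS.comp (Continuous.prodMk_right t)
  have hc1 : Continuous fun x => (Complex.I * ((starRingEnd ℂ) (ψ t x) * ψxx t x)).re :=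
    Complex.continuous_re.comp
      (continuous_const.mul ((Complex.continuous_conj.comp (H.cψs t)).mul (H.cxx t)))
  have hc2 : Continuous fun x => 2 * ((starRingEnd ℂ) (ψ t x) * S t x).re :=
    continuous_const.mul (Complex.continuous_re.comp
      ((Complex.continuous_conj.comp (H.cψs t)).mul hS))
  have e1 : (∫ x in (0:ℝ)..L, 2 * ((starRingEnd ℂ) (ψ t x) * ψt t x).re)
      = (∫ x in (0:ℝ)..L, (Complex.I * ((starRingEnd ℂ) (ψ t x) * ψxx t x)).re)
      + ∫ x in (0:ℝ)..L, 2 * ((starRingEnd ℂ) (ψ t x) * S t x).re := by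
    rw [← intervalIntegral.integral_add (hc1.intervalIntegrable _ _)
      (hc2.intervalIntegrable _ _)]
    congr 1
    ext x
    rw [H.eq t x]
    simp only [Complex.mul_re, Complex.mul_im, Complex.add_re, Complex.add_im, Complex.I_re,
      Complex.I_im, Complex.conj_re, Complex.conj_im, Complex.div_ofNat_re,
      Complex.div_ofNat_im]
    ring
  rw [e1, aux_parts _ _ _ 0 L (H.d1 t) (H.d2 t) (H.cxx t), h0, h1, sub_self, zero_add]


set_option maxHeartbeats 1000000 in

/-- Lemma 5.2: for a classical `L`-periodic solution of the adiabatic Gross–Pitaevskii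
equation with `PR - αβ < 0`, the condensate mass decays exponentially:
with `κ = (αβ - PR)/(2β) > 0`, `∫₀^L |ψ(t)|² ≤ e^{-2κt} ∫₀^L |ψ(0)|²`. -/
theorem stmt_18 (g lam α β R P L : ℝ)
    (hg : 0 < g) (hlam : 0 < lam) (hα : 0 < α) (hβ : 0 < β) (hR : 0 < R) (hP : 0 < P)
    (hL : 0 < L) (h : P * R - α * β < 0)
    (ψ : ℝ → ℝ → ℂ) (ψt ψx ψxx : ℝ → ℝ → ℂ)
    -- `L`-periodicity in space
    (hper_ψ : ∀ t x, ψ t (x + L) = ψ t x)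
    -- continuity of the solution
    (hψ_cont : ContinuousOn (fun p : ℝ × ℝ => ψ p.1 p.2) (Set.Ici 0 ×ˢ Set.univ))
    -- `ψ` continuously differentiable in time
    (hψt : ∀ t ∈ Set.Ici (0:ℝ), ∀ x, HasDerivWithinAt (fun s => ψ s x) (ψt t x) (Set.Ici 0) t)
    (hψt_cont : ∀ x, ContinuousOn (fun t => ψt t x) (Set.Ici 0))
    -- `ψ` twice continuously differentiable in space, with `∂ₓψ` continuous in `(t,x)`
    (hψx : ∀ t ∈ Set.Ici (0:ℝ), ∀ x, HasDerivAt (fun y => ψ t y) (ψx t x) x)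
    (hψx_cont : ContinuousOn (fun p : ℝ × ℝ => ψx p.1 p.2) (Set.Ici 0 ×ˢ Set.univ))
    (hψxx : ∀ t ∈ Set.Ici (0:ℝ), ∀ x, HasDerivAt (fun y => ψx t y) (ψxx t x) x)
    (hψxx_cont : ∀ t ∈ Set.Ici (0:ℝ), Continuous (fun x => ψxx t x))
    -- the adiabatic Gross-Pitaevskii equation (5.2)
    (heq : ∀ t ∈ Set.Ici (0:ℝ), ∀ x,
      Complex.I * ψt t x = -(1/2 : ℂ) * ψxx t x
        + ((g * ‖ψ t x‖ ^ 2 : ℝ) : ℂ) * ψ t x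
        + ((lam * P : ℝ) : ℂ) * ψ t x / ((β + R * ‖ψ t x‖ ^ 2 : ℝ) : ℂ)
        + (Complex.I / 2)
          * (((P * R : ℝ) : ℂ) / ((β + R * ‖ψ t x‖ ^ 2 : ℝ) : ℂ) - (α : ℂ))
          * ψ t x) :
    0 < (α * β - P * R) / (2 * β) ∧
    ∀ t ∈ Set.Ici (0:ℝ),
      (∫ x in (0:ℝ)..L, ‖ψ t x‖ ^ 2)
        ≤ Real.exp (-2 * ((α * β - P * R) / (2 * β)) * t)
          * (∫ x in (0:ℝ)..L, ‖ψ 0 x‖ ^ 2) := by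
  have hκ : 0 < (α * β - P * R) / (2 * β) := div_pos (by linarith) (by linarith)
  refine ⟨hκ, ?_⟩
  intro T hT
  have hT0 : (0:ℝ) ≤ T := hT
  set κ := (α * β - P * R) / (2 * β) with hκdef
  set m : ℝ → ℝ := fun t => max t 0 with hm
  have hmc : Continuous m := continuous_id.max continuous_const
  have hm0 : ∀ t, m t ∈ Set.Ici (0:ℝ) := fun t => le_max_right t 0
  have hmt : ∀ t, 0 ≤ t → m t = t := fun t ht => max_eq_left ht
  have hmc2 : Continuous fun p : ℝ × ℝ => (m p.1, p.2) :=
    (hmc.comp continuous_fst).prodMk continuous_snd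
  set ρ : ℝ → ℝ → ℝ := fun t x => β + R * ‖ψ (m t) x‖^2 with hρ
  have hρpos : ∀ t x, 0 < ρ t x := fun t x => by simp only [hρ]; positivity
  set S : ℝ → ℝ → ℂ := fun t x => -Complex.I * (((g * ‖ψ (m t) x‖ ^ 2 : ℝ) : ℂ) * ψ (m t) x
        + ((lam * P : ℝ) : ℂ) * ψ (m t) x / ((ρ t x : ℝ) : ℂ)
        + (Complex.I / 2)
          * (((P * R : ℝ) : ℂ) / ((ρ t x : ℝ) : ℂ) - (α : ℂ))
          * ψ (m t) x) with hS
  have cψ : Continuous (fun p : ℝ × ℝ => ψ (m p.1) p.2) :=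
    hψ_cont.comp_continuous hmc2 (fun p => ⟨hm0 _, Set.mem_univ _⟩)
  have cρ : Continuous (fun p : ℝ × ℝ => ((ρ p.1 p.2 : ℝ) : ℂ)) :=
    Complex.continuous_ofReal.comp
      (continuous_const.add (continuous_const.mul (cψ.norm.pow 2)))
  have hρne : ∀ p : ℝ × ℝ, ((ρ p.1 p.2 : ℝ) : ℂ) ≠ 0 := fun p =>
    Complex.ofReal_ne_zero.2 (hρpos _ _).ne'
  have H : AuxSetup T (fun t => ψ (m t)) (fun t => ψt (m t)) (fun t => ψx (m t))
      (fun t => ψxx (m t)) S := by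
    refine ⟨cψ, ?_, ?_, ?_, ?_, ?_, ?_, ?_, ?_⟩
    · exact hψx_cont.comp_continuous hmc2 (fun p => ⟨hm0 _, Set.mem_univ _⟩)
    · have c1 : Continuous (fun p : ℝ × ℝ => ((g * ‖ψ (m p.1) p.2‖ ^ 2 : ℝ) : ℂ)) :=
        Complex.continuous_ofReal.comp (continuous_const.mul (cψ.norm.pow 2))
      exact continuous_const.mul (((c1.mul cψ).add ((continuous_const.mul cψ).div cρ hρne)).add
        ((continuous_const.mul ((continuous_const.div cρ hρne).sub continuous_const)).mul cψ))
    · intro x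
      exact (hψt_cont x).comp_continuous hmc hm0
    · exact fun t => hψxx_cont _ (hm0 t)
    · exact fun t x => hψx _ (hm0 t) x
    · exact fun t x => hψxx _ (hm0 t) x
    · intro t ht x
      simp only [hmt t ht.1]
      refine ((hψt t ht.1 x).mono Set.Icc_subset_Ici_self).congr_of_mem ?_ ht
      intro s hs
      simp only [hmt s hs.1]
    · intro t x
      have e := heq (m t) (hm0 t) x
      have e2 : ψt (m t) x = -Complex.I * (Complex.I * ψt (m t) x) := by
        rw [← mul_assoc, neg_mul, Complex.I_mul_I]; ring
      rw [e2, e]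
      simp only [hS, hρ]
      ring
  have hper : ∀ t, ψ (m t) L = ψ (m t) 0 := fun t => by simpa using hper_ψ (m t) 0
  have hperx : ∀ t, ψx (m t) L = ψx (m t) 0 := fun t => by
    have h1 : HasDerivAt (fun y => ψ (m t) (y + L)) (ψx (m t) (0 + L)) 0 :=
      (hψx (m t) (hm0 t) (0 + L)).comp_add_const 0 L
    have h2 : (fun y => ψ (m t) (y + L)) = ψ (m t) := funext (hper_ψ (m t))
    rw [h2] at h1
    have := h1.unique (hψx (m t) (hm0 t) 0)
    simpa using this
  set q : ℝ → ℝ := fun t => ∫ x in (0:ℝ)..L, ‖ψ (m t) x‖^2 with hq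
  set q' : ℝ → ℝ := fun t => ∫ x in (0:ℝ)..L, 2 * ((starRingEnd ℂ) (ψ (m t) x) * S t x).re with hq'
  have hder : ∀ t ∈ Set.Icc 0 T, HasDerivWithinAt q (q' t) (Set.Icc 0 T) t := fun t ht =>
    aux_mass_deriv H L hL.le t ht (hper t) (hperx t)
  have hle : ∀ t, q' t ≤ -2 * κ * q t := by
    intro t
    simp only [hq, hq']
    rw [← intervalIntegral.integral_const_mul]
    have c1 : Continuous (S t) := H.cSs t
    have c2 := H.cψs t
    apply intervalIntegral.integral_mono_on hL.le
    · exact (continuous_const.mul (Complex.continuous_re.comp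
        ((Complex.continuous_conj.comp c2).mul c1))).intervalIntegrable _ _
    · exact (continuous_const.mul (c2.norm.pow 2)).intervalIntegrable _ _
    intro x _
    have e : 2 * ((starRingEnd ℂ) (ψ (m t) x) * S t x).re
        = (P * R / ρ t x - α) * ‖ψ (m t) x‖^2 := by
      have e1 : (starRingEnd ℂ) (ψ (m t) x) * S t x
          = (-Complex.I * (((g * ‖ψ (m t) x‖ ^ 2 + lam * P / ρ t x : ℝ)) : ℂ)
            + (((P * R / ρ t x - α) / 2 : ℝ) : ℂ))
            * (ψ (m t) x * (starRingEnd ℂ) (ψ (m t) x)) := by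
        simp only [hS]
        push_cast
        linear_combination (-(1/2 : ℂ) * ((P:ℂ) * R / (ρ t x : ℂ) - α) *
          (ψ (m t) x * (starRingEnd ℂ) (ψ (m t) x))) * Complex.I_mul_I
      rw [e1, Complex.mul_conj, Complex.normSq_eq_norm_sq, Complex.re_mul_ofReal, Complex.add_re,
        Complex.ofReal_re, neg_mul, Complex.neg_re, Complex.I_mul_re, Complex.ofReal_im]
      ring
    rw [e]
    have e2 : -2 * κ = P * R / β - α := by rw [hκdef]; field_simp; ring
    rw [e2]
    have e3 : P * R / ρ t x ≤ P * R / β := by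
      apply div_le_div_of_nonneg_left (by positivity) hβ
      simp only [hρ]
      have : 0 ≤ R * ‖ψ (m t) x‖^2 := by positivity
      linarith
    gcongr
  have hanti : AntitoneOn (fun t => Real.exp (2 * κ * t) * q t) (Set.Icc 0 T) := by
    have hd : ∀ t ∈ Set.Icc 0 T, HasDerivWithinAt (fun t => Real.exp (2 * κ * t) * q t)
        (Real.exp (2 * κ * t) * (2 * κ * 1) * q t + Real.exp (2 * κ * t) * q' t)
        (Set.Icc 0 T) t := by
      intro t ht
      have h1 : HasDerivAt (fun t => Real.exp (2 * κ * t)) (Real.exp (2 * κ * t) * (2 * κ * 1)) t :=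
        ((hasDerivAt_id t).const_mul (2 * κ)).exp
      exact h1.hasDerivWithinAt.mul (hder t ht)
    apply antitoneOn_of_hasDerivWithinAt_nonpos (convex_Icc 0 T)
      (fun t ht => (hd t ht).continuousWithinAt)
      (fun t ht => (hd t (interior_subset ht)).mono interior_subset)
    intro t ht
    have h1 := hle t
    have h2 := Real.exp_pos (2 * κ * t)
    have h3 : Real.exp (2 * κ * t) * (2 * κ * 1) * q t + Real.exp (2 * κ * t) * q' t
      = Real.exp (2 * κ * t) * (q' t - (-2 * κ * q t)) := by ring
    rw [h3]
    exact mul_nonpos_of_nonneg_of_nonpos h2.le (by linarith)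
  have hfin := hanti (Set.left_mem_Icc.2 hT0) (Set.right_mem_Icc.2 hT0) hT0
  simp only [hq, hmt T hT0, hmt 0 le_rfl, mul_zero, Real.exp_zero, one_mul] at hfin
  have hexp : Real.exp (-2 * κ * T) * Real.exp (2 * κ * T) = 1 := by
    rw [← Real.exp_add]; simp
  calc (∫ x in (0:ℝ)..L, ‖ψ T x‖^2)
      = Real.exp (-2 * κ * T) * (Real.exp (2 * κ * T) * ∫ x in (0:ℝ)..L, ‖ψ T x‖^2) := by
        rw [← mul_assoc, hexp, one_mul]
    _ ≤ _ := by gcongr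
end
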